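/- arXiv:2010.05417 — 7 statements merged into one kernel-verified Lean document; each statement's English description precedes it below -/
import Mathlib

section
/- Let f : (0,∞) → ℝ be measurable and essentially bounded, and suppose that the limit lim_{T→∞} ∫₀^T f(t) dt = A exists. Then for every α > 0 one has lim_{T→∞} ∫₀^T (1 − t²/T²)^α f(t) dt = A. -/
open MeasureTheory Filter Set

/-- A function essentially bounded on `(0, ∞)` is integrable on every `(0, T]`. -/
lemma integrableOn_Ioc_of_ae_abs_le {f : ℝ → ℝ} (hmeas : Measurable f) {M : ℝ}
    (hM : ∀ᵐ t ∂(volume.restrict (Ioi (0 : ℝ))), |f t| ≤ M) (T : ℝ) :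
    IntegrableOn f (Ioc 0 T) :=
  Integrable.of_bound hmeas.aestronglyMeasurable M
    (ae_restrict_of_ae_restrict_of_subset Ioc_subset_Ioi_self hM)

lemma measurable_integral_Ioc {f : ℝ → ℝ} (hmeas : Measurable f) :
    Measurable fun T : ℝ => ∫ t in Ioc (0 : ℝ) T, f t := by
  have hS : MeasurableSet {p : ℝ × ℝ | p.2 ∈ Ioc 0 p.1} :=
    (measurableSet_lt measurable_const measurable_snd).inter
      (measurableSet_le measurable_snd measurable_fst)
  have h : StronglyMeasurable fun p : ℝ × ℝ => {p : ℝ × ℝ | p.2 ∈ Ioc 0 p.1}.indicator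
      (fun p => f p.2) p :=
    ((hmeas.comp measurable_snd).indicator hS).stronglyMeasurable
  simp_rw [← integral_indicator measurableSet_Ioc]
  exact (h.integral_prod_right' (ν := volume)).measurable

lemma exists_forall_abs_integral_Ioc_le {f : ℝ → ℝ} {M : ℝ}
    (hM : ∀ᵐ t ∂(volume.restrict (Ioi (0 : ℝ))), |f t| ≤ M) {A : ℝ}
    (hlim : Tendsto (fun T : ℝ => ∫ t in Ioc (0 : ℝ) T, f t) atTop (nhds A)) :
    ∃ C : ℝ, ∀ T : ℝ, |∫ t in Ioc (0 : ℝ) T, f t| ≤ C := by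
  obtain ⟨T₀, hT₀⟩ := eventually_atTop.1 (hlim.abs.eventually_le_const (lt_add_one |A|))
  refine ⟨max (|A| + 1) (|M| * |T₀|), fun T => ?_⟩
  rcases le_total T₀ T with h | h
  · exact (hT₀ T h).trans (le_max_left _ _)
  · refine le_trans ?_ (le_max_right _ _)
    have hb : ∀ᵐ t ∂(volume.restrict (Ioc (0 : ℝ) T)), ‖f t‖ ≤ |M| :=
      (ae_restrict_of_ae_restrict_of_subset Ioc_subset_Ioi_self hM).mono
        fun t ht => ht.trans (le_abs_self M)
    refine (norm_integral_le_of_norm_le_const hb).trans ?_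
    gcongr
    simp only [measureReal_restrict_apply_univ, Real.volume_real_Ioc, sub_zero]
    exact max_le (h.trans (le_abs_self _)) (abs_nonneg _)

lemma le_one_sub_sq_div_sq_rpow_iff {α T t u : ℝ} (hα : 0 < α) (ht : t ∈ Ioc 0 T)
    (hu : 0 ≤ u) :
    u ≤ (1 - t ^ 2 / T ^ 2) ^ α ↔ t ≤ T * √(1 - u ^ α⁻¹) := by
  obtain ⟨ht0, htT⟩ := ht
  have hT : 0 < T := ht0.trans_le htT
  have h1 : t ^ 2 / T ^ 2 ≤ 1 := (div_le_one (by positivity)).2 (by gcongr)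
  rw [← Real.rpow_inv_le_iff_of_pos hu (sub_nonneg.2 h1) hα, mul_comm, ← div_le_iff₀ hT,
    Real.le_sqrt' (by positivity), div_pow, le_sub_comm]

/-- The Riesz mean of `f` is an average of the primitive of `f`. -/
lemma integral_one_sub_sq_div_sq_rpow_mul {f : ℝ → ℝ} {α T : ℝ} (hα : 0 < α)
    (hf : IntegrableOn f (Ioc 0 T)) :
    ∫ t in Ioc (0 : ℝ) T, (1 - t ^ 2 / T ^ 2) ^ α * f t =
      ∫ u in Ioc (0 : ℝ) 1, ∫ t in Ioc (0 : ℝ) (T * √(1 - u ^ α⁻¹)), f t := by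
  set w : ℝ → ℝ := fun t => (1 - t ^ 2 / T ^ 2) ^ α with hw
  have hS : MeasurableSet {p : ℝ × ℝ | p.2 ≤ w p.1} :=
    measurableSet_le measurable_snd (by fun_prop)
  have hint : Integrable (fun p : ℝ × ℝ => {p : ℝ × ℝ | p.2 ≤ w p.1}.indicator
      (fun p => f p.1) p)
      ((volume.restrict (Ioc (0 : ℝ) T)).prod (volume.restrict (Ioc (0 : ℝ) 1))) :=
    (hf.comp_fst _).indicator hS
  calc ∫ t in Ioc (0 : ℝ) T, w t * f t
      = ∫ t in Ioc (0 : ℝ) T, ∫ u in Ioc (0 : ℝ) 1,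
          {p : ℝ × ℝ | p.2 ≤ w p.1}.indicator (fun p => f p.1) (t, u) := by
        refine setIntegral_congr_fun measurableSet_Ioc fun t ht => ?_
        have hT : 0 < T := ht.1.trans_le ht.2
        have h1 : t ^ 2 / T ^ 2 ≤ 1 :=
          (div_le_one (by positivity)).2 (by have := ht.1.le; gcongr; exact ht.2)
        have hw0 : 0 ≤ w t := Real.rpow_nonneg (sub_nonneg.2 h1) _
        have hw1 : w t ≤ 1 :=
          Real.rpow_le_one (sub_nonneg.2 h1) (sub_le_self _ (by positivity)) hα.le
        have hset : Ioc (0 : ℝ) 1 ∩ Iic (w t) = Ioc 0 (w t) := by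
          rw [Ioc_inter_Iic, min_eq_right hw1]
        change w t * f t = ∫ u in Ioc (0 : ℝ) 1, (Iic (w t)).indicator (fun _ => f t) u
        rw [setIntegral_indicator measurableSet_Iic, hset]
        simp [hw0]
    _ = ∫ u in Ioc (0 : ℝ) 1, ∫ t in Ioc (0 : ℝ) T,
          {p : ℝ × ℝ | p.2 ≤ w p.1}.indicator (fun p => f p.1) (t, u) :=
        integral_integral_swap hint
    _ = _ := by
        refine setIntegral_congr_fun measurableSet_Ioc fun u hu => ?_
        have hset : Ioc (0 : ℝ) T ∩ {t | u ≤ w t} = Ioc 0 (T * √(1 - u ^ α⁻¹)) := by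
          ext t
          constructor
          · rintro ⟨ht, h⟩
            exact ⟨ht.1, (le_one_sub_sq_div_sq_rpow_iff hα ht hu.1.le).1 h⟩
          · rintro ⟨ht0, h⟩
            have hT : 0 < T := pos_of_mul_pos_left (ht0.trans_le h) (Real.sqrt_nonneg _)
            have hs : √(1 - u ^ α⁻¹) ≤ 1 :=
              Real.sqrt_le_one.2 (sub_le_self _ (Real.rpow_nonneg hu.1.le _))
            have ht : t ∈ Ioc 0 T := ⟨ht0, h.trans (mul_le_of_le_one_right hT.le hs)⟩
            exact ⟨ht, (le_one_sub_sq_div_sq_rpow_iff hα ht hu.1.le).2 h⟩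
        change ∫ t in Ioc (0 : ℝ) T, {t | u ≤ w t}.indicator f t = _
        rw [setIntegral_indicator (measurableSet_le measurable_const (by fun_prop)), hset]

/-- **Abelian lemma** (Lemma A.3 of the paper).
Let `f : (0,∞) → ℝ` be measurable and essentially bounded, and suppose that
`lim_{T→∞} ∫₀^T f(t) dt = A`. Then for every `α > 0`,
`lim_{T→∞} ∫₀^T (1 − t²/T²)^α f(t) dt = A`. -/
theorem abelian_lemma (f : ℝ → ℝ) (hmeas : Measurable f)
    (hbdd : ∃ M : ℝ, ∀ᵐ t ∂(volume.restrict (Set.Ioi (0 : ℝ))), |f t| ≤ M)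
    (A : ℝ)
    (hlim : Tendsto (fun T : ℝ => ∫ t in Set.Ioc (0 : ℝ) T, f t) atTop (nhds A))
    (α : ℝ) (hα : 0 < α) :
    Tendsto (fun T : ℝ => ∫ t in Set.Ioc (0 : ℝ) T, (1 - t ^ 2 / T ^ 2) ^ α * f t)
      atTop (nhds A) := by
  obtain ⟨M, hM⟩ := hbdd
  obtain ⟨C, hC⟩ := exists_forall_abs_integral_Ioc_le hM hlim
  simp_rw [fun T => integral_one_sub_sq_div_sq_rpow_mul hα
    (integrableOn_Ioc_of_ae_abs_le hmeas hM T),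
    integral_Ioc_eq_integral_Ioo (x := (0 : ℝ)) (y := 1)]
  have hA : A = ∫ _ in Ioo (0 : ℝ) 1, A := by simp
  rw [hA]
  refine tendsto_integral_filter_of_dominated_convergence (fun _ => C) ?_ ?_
    (integrable_const C) ?_
  · exact Eventually.of_forall fun T =>
      ((measurable_integral_Ioc hmeas).comp (by fun_prop)).aestronglyMeasurable
  · exact Eventually.of_forall fun T => Eventually.of_forall fun u => hC _
  · refine (ae_restrict_iff' measurableSet_Ioo).2 (Eventually.of_forall fun u hu => ?_)
    have hpos : 0 < √(1 - u ^ α⁻¹) :=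
      Real.sqrt_pos.2 (sub_pos.2 (Real.rpow_lt_one hu.1.le hu.2 (inv_pos.2 hα)))
    exact hlim.comp (tendsto_id.atTop_mul_const hpos)
end

section
/- Let ν ∈ ℝ and let u, v : (0,∞) → ℝ be continuous and satisfy the Bessel recurrence relations of order ν. Assume that x²(u(x)² + v(x)²) → 0 and x u(x) v(x) → 0 as x → 0⁺. Then for every T > 0 the function t ↦ t u(t)² is Lebesgue integrable on (0,T) and ∫₀^T t u(t)² dt = (T²/2) u(T)² + (T²/2) v(T)² − ν T u(T) v(T). -/
open MeasureTheory Filter Set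

/-- The primitive of `t ↦ t * u t ^ 2` attached to a solution of the Bessel recurrence relations. -/
theorem hasDerivAt_bessel_primitive {ν x : ℝ} {u v : ℝ → ℝ} (hx : x ≠ 0)
    (hu : HasDerivAt u (ν / x * u x - v x) x)
    (hv : HasDerivAt v (u x - (ν + 1) / x * v x) x) :
    HasDerivAt (fun t => t ^ 2 / 2 * u t ^ 2 + t ^ 2 / 2 * v t ^ 2 - ν * t * u t * v t)
      (x * u x ^ 2) x := by
  have hsq : HasDerivAt (fun t : ℝ => t ^ 2 / 2) x x := by
    simpa using (hasDerivAt_pow 2 x).div_const 2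
  have hlin : HasDerivAt (fun t : ℝ => ν * t) ν x := by
    simpa using (hasDerivAt_id x).const_mul ν
  refine (((hsq.mul (hu.pow 2)).add (hsq.mul (hv.pow 2))).sub
    ((hlin.mul hu).mul hv)).congr_deriv ?_
  simp only [Pi.mul_apply, Pi.pow_apply]
  field_simp
  ring

/-- The integrated form of the Bessel differentiation identity: if `u, v` are
continuous on `(0,∞)`, satisfy the Bessel recurrence relations of order `ν`, and
`x²(u(x)² + v(x)²) → 0`, `x u(x) v(x) → 0` as `x → 0⁺`, then for every `T > 0`
the function `t ↦ t u(t)²` is integrable on `(0,T)` and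
`∫₀^T t u(t)² dt = (T²/2) u(T)² + (T²/2) v(T)² − ν T u(T) v(T)`. -/
theorem bessel_integral_identity (ν : ℝ) (u v : ℝ → ℝ)
    (hu_cont : ContinuousOn u (Set.Ioi 0)) (hv_cont : ContinuousOn v (Set.Ioi 0))
    (hu : ∀ x > (0 : ℝ), HasDerivAt u (ν / x * u x - v x) x)
    (hv : ∀ x > (0 : ℝ), HasDerivAt v (u x - (ν + 1) / x * v x) x)
    (hlim1 : Tendsto (fun x => x ^ 2 * ((u x) ^ 2 + (v x) ^ 2))
      (nhdsWithin 0 (Set.Ioi 0)) (nhds 0))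
    (hlim2 : Tendsto (fun x => x * u x * v x) (nhdsWithin 0 (Set.Ioi 0)) (nhds 0)) :
    ∀ T > (0 : ℝ),
      IntegrableOn (fun t => t * (u t) ^ 2) (Set.Ioc 0 T) ∧
      ∫ t in Set.Ioc (0 : ℝ) T, t * (u t) ^ 2
        = T ^ 2 / 2 * (u T) ^ 2 + T ^ 2 / 2 * (v T) ^ 2 - ν * T * u T * v T := by
  intro T hT
  set F : ℝ → ℝ := fun t => t ^ 2 / 2 * u t ^ 2 + t ^ 2 / 2 * v t ^ 2 - ν * t * u t * v t with hF
  have hderiv : ∀ x > 0, HasDerivAt F (x * u x ^ 2) x := fun x hx =>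
    hasDerivAt_bessel_primitive hx.ne' (hu x hx) (hv x hx)
  have hlim : Tendsto F (nhdsWithin 0 (Ioi 0)) (nhds 0) := by
    have h := (hlim1.const_mul (1 / 2)).sub (hlim2.const_mul ν)
    simp only [mul_zero, sub_zero] at h
    exact h.congr fun x => by simp only [hF]; ring
  have hderiv' : ∀ x ∈ Ioo 0 T, HasDerivAt (Function.update F 0 0) (x * u x ^ 2) x := fun x hx =>
    (hderiv x hx.1).congr_of_eventuallyEq <| by
      filter_upwards [Ioi_mem_nhds hx.1] with y hy
      exact Function.update_of_ne (ne_of_gt hy) _ _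
  have hcont : ContinuousOn (Function.update F 0 0) (Icc 0 T) := by
    intro x hx
    rcases hx.1.eq_or_lt with rfl | hx0
    · refine continuousWithinAt_update_same.2 (hlim.mono_left (nhdsWithin_mono _ ?_))
      exact fun y hy => lt_of_le_of_ne hy.1.1 (Ne.symm hy.2)
    · exact ((continuousAt_update_of_ne hx0.ne').2 (hderiv x hx0).continuousAt).continuousWithinAt
  have hint : IntegrableOn (fun t => t * u t ^ 2) (Ioc 0 T) :=
    intervalIntegral.integrableOn_deriv_of_nonneg hcont hderiv' fun x hx =>
      mul_nonneg hx.1.le (sq_nonneg _)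
  refine ⟨hint, ?_⟩
  rw [← intervalIntegral.integral_of_le hT.le,
    intervalIntegral.integral_eq_sub_of_hasDerivAt_of_le hT.le hcont hderiv'
      ((intervalIntegrable_iff_integrableOn_Ioc_of_le hT.le).2 hint),
    Function.update_self, Function.update_of_ne hT.ne', sub_zero]
end

section
/- Let d ≥ 2 be an integer, let 0 ≤ ε ≤ 1, and let f : ℝ^{d−1} → ℝ be continuously differentiable with ‖∇f(y)‖ ≤ ε for all y. Let u : ℝ^d → ℝ be continuously differentiable with compact support, and set ũ = u ∘ Φ^{-1}. Then ũ is continuously differentiable with compact support and |∫_{ℝ^d} ‖∇u(x)‖² dx − ∫_{ℝ^d} ‖∇ũ(y)‖² dy| ≤ (2ε + ε²) ∫_{ℝ^d} ‖∇ũ(y)‖² dy. -/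
open MeasureTheory Filter Set

/-- The squared Euclidean length of the gradient of `u : ℝ^{d−1} × ℝ → ℝ` at the
point `x`, written via the partial gradient in the `ℝ^{d−1}`-variable (Euclidean
operator norm) and the partial derivative in the last variable. -/
noncomputable def gradSq {m : ℕ} (u : EuclideanSpace ℝ (Fin m) × ℝ → ℝ)
    (x : EuclideanSpace ℝ (Fin m) × ℝ) : ℝ :=
  ‖fderiv ℝ (fun y => u (y, x.2)) x.1‖ ^ 2 + (deriv (fun t => u (x.1, t)) x.2) ^ 2

theorem fderiv_slice_left {m : ℕ} {u : EuclideanSpace ℝ (Fin m) × ℝ → ℝ}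
    (hu : Differentiable ℝ u) (x : EuclideanSpace ℝ (Fin m) × ℝ) :
    fderiv ℝ (fun y => u (y, x.2)) x.1 =
      (fderiv ℝ u x).comp (ContinuousLinearMap.inl ℝ (EuclideanSpace ℝ (Fin m)) ℝ) :=
  ((hu x).hasFDerivAt.comp x.1 (hasFDerivAt_prodMk_left x.1 x.2)).fderiv

theorem deriv_slice_right {m : ℕ} {u : EuclideanSpace ℝ (Fin m) × ℝ → ℝ}
    (hu : Differentiable ℝ u) (x : EuclideanSpace ℝ (Fin m) × ℝ) :
    deriv (fun t => u (x.1, t)) x.2 = fderiv ℝ u x (0, 1) := by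
  have h := ((hu x).hasFDerivAt.comp x.2 (hasFDerivAt_prodMk_right x.1 x.2)).hasDerivAt.deriv
  simpa [Function.comp_def] using h

theorem gradSq_eq {m : ℕ} {u : EuclideanSpace ℝ (Fin m) × ℝ → ℝ}
    (hu : Differentiable ℝ u) (x : EuclideanSpace ℝ (Fin m) × ℝ) :
    gradSq u x =
      ‖(fderiv ℝ u x).comp (ContinuousLinearMap.inl ℝ (EuclideanSpace ℝ (Fin m)) ℝ)‖ ^ 2
        + (fderiv ℝ u x (0, 1)) ^ 2 := by
  rw [gradSq, fderiv_slice_left hu, deriv_slice_right hu]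

theorem integrable_gradSq {m : ℕ} {u : EuclideanSpace ℝ (Fin m) × ℝ → ℝ}
    (hu : ContDiff ℝ 1 u) (hsupp : HasCompactSupport u) : Integrable (gradSq u) := by
  have heq := funext (gradSq_eq (hu.differentiable one_ne_zero))
  have hc : Continuous (fderiv ℝ u) := hu.continuous_fderiv one_ne_zero
  rw [heq]
  refine Continuous.integrable_of_hasCompactSupport ?_ ?_
  · fun_prop
  · exact (hsupp.fderiv (𝕜 := ℝ)).comp_left
      (g := fun A : EuclideanSpace ℝ (Fin m) × ℝ →L[ℝ] ℝ =>
        ‖A.comp (ContinuousLinearMap.inl ℝ (EuclideanSpace ℝ (Fin m)) ℝ)‖ ^ 2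
          + (A (0, 1)) ^ 2) (by simp)

/-- The inverse shear `(y, t) ↦ (y, t + f y)` as a homeomorphism. -/
def shearHomeomorph {m : ℕ} (f : EuclideanSpace ℝ (Fin m) → ℝ) (hf : Continuous f) :
    (EuclideanSpace ℝ (Fin m) × ℝ) ≃ₜ (EuclideanSpace ℝ (Fin m) × ℝ) where
  toFun q := (q.1, q.2 + f q.1)
  invFun q := (q.1, q.2 - f q.1)
  left_inv q := by simp
  right_inv q := by simp
  continuous_toFun := by fun_prop
  continuous_invFun := by fun_prop

theorem measurePreserving_shearHomeomorph {m : ℕ} (f : EuclideanSpace ℝ (Fin m) → ℝ)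
    (hf : Continuous f) : MeasurePreserving (shearHomeomorph f hf) := by
  have hg : Measurable (Function.uncurry fun (y : EuclideanSpace ℝ (Fin m)) (t : ℝ) => t + f y) :=
    Continuous.measurable (by unfold Function.uncurry; fun_prop)
  exact (MeasurePreserving.id volume).skew_product hg
    (Eventually.of_forall fun y => map_add_right_eq_self volume (f y))

/-- Subtracting `s • g` with `‖g‖ ≤ ε` changes `‖L‖²` by at most `(2ε + ε²)(‖L‖² + s²)`. -/
theorem abs_norm_sub_smul_sq_sub_le {E : Type*} [NormedAddCommGroup E] [NormedSpace ℝ E]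
    {ε : ℝ} (hε : 0 ≤ ε) (L g : E) (s : ℝ) (hg : ‖g‖ ≤ ε) :
    |‖L - s • g‖ ^ 2 - ‖L‖ ^ 2| ≤ (2 * ε + ε ^ 2) * (‖L‖ ^ 2 + s ^ 2) := by
  have hs : ‖s • g‖ ≤ ε * |s| := by
    rw [norm_smul, Real.norm_eq_abs, mul_comm]
    gcongr
  have hdiff : |‖L - s • g‖ - ‖L‖| ≤ ε * |s| :=
    (abs_norm_sub_norm_le _ _).trans (by simpa using hs)
  have hsum : ‖L - s • g‖ + ‖L‖ ≤ 2 * ‖L‖ + ε * |s| := by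
    linarith [norm_sub_le L (s • g)]
  have hfac : ‖L - s • g‖ ^ 2 - ‖L‖ ^ 2 =
      (‖L - s • g‖ - ‖L‖) * (‖L - s • g‖ + ‖L‖) := by ring
  rw [hfac, abs_mul, abs_of_nonneg (by positivity : 0 ≤ ‖L - s • g‖ + ‖L‖)]
  calc |‖L - s • g‖ - ‖L‖| * (‖L - s • g‖ + ‖L‖)
      ≤ (ε * |s|) * (2 * ‖L‖ + ε * |s|) := by gcongr
    _ = ε * (2 * ‖L‖ * |s|) + ε ^ 2 * s ^ 2 := by rw [← sq_abs s]; ring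
    _ ≤ (2 * ε + ε ^ 2) * (‖L‖ ^ 2 + s ^ 2) := by
      have h := mul_le_mul_of_nonneg_left (two_mul_le_add_sq ‖L‖ |s|) hε
      rw [sq_abs] at h
      nlinarith [mul_nonneg (sq_nonneg ε) (sq_nonneg ‖L‖),
        mul_nonneg hε (add_nonneg (sq_nonneg ‖L‖) (sq_nonneg s))]

theorem hasFDerivAt_comp_shear {m : ℕ} {f : EuclideanSpace ℝ (Fin m) → ℝ}
    (hf : Differentiable ℝ f) {u : EuclideanSpace ℝ (Fin m) × ℝ → ℝ} (hu : Differentiable ℝ u)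
    (q : EuclideanSpace ℝ (Fin m) × ℝ) :
    HasFDerivAt (fun q : EuclideanSpace ℝ (Fin m) × ℝ => u (q.1, q.2 + f q.1))
      ((fderiv ℝ u (q.1, q.2 + f q.1)).comp
        ((ContinuousLinearMap.fst ℝ (EuclideanSpace ℝ (Fin m)) ℝ).prod
          (ContinuousLinearMap.snd ℝ (EuclideanSpace ℝ (Fin m)) ℝ
            + (fderiv ℝ f q.1).comp (ContinuousLinearMap.fst ℝ (EuclideanSpace ℝ (Fin m)) ℝ)))) q :=
  (hu (q.1, q.2 + f q.1)).hasFDerivAt.comp q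
    (hasFDerivAt_fst.prodMk
      (hasFDerivAt_snd.add ((hf q.1).hasFDerivAt.comp q hasFDerivAt_fst)))

theorem abs_gradSq_sub_gradSq_comp_shear_le {m : ℕ} {ε : ℝ} (hε : 0 ≤ ε)
    {f : EuclideanSpace ℝ (Fin m) → ℝ} (hf : Differentiable ℝ f)
    (hgrad : ∀ y, ‖fderiv ℝ f y‖ ≤ ε)
    {u : EuclideanSpace ℝ (Fin m) × ℝ → ℝ} (hu : Differentiable ℝ u)
    (q : EuclideanSpace ℝ (Fin m) × ℝ) :
    |gradSq u (q.1, q.2 + f q.1)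
        - gradSq (fun q : EuclideanSpace ℝ (Fin m) × ℝ => u (q.1, q.2 + f q.1)) q|
      ≤ (2 * ε + ε ^ 2)
        * gradSq (fun q : EuclideanSpace ℝ (Fin m) × ℝ => u (q.1, q.2 + f q.1)) q := by
  have hD := fun q => hasFDerivAt_comp_shear hf hu q
  rw [gradSq_eq hu, gradSq_eq fun q => (hD q).differentiableAt, (hD q).fderiv]
  set A := fderiv ℝ u (q.1, q.2 + f q.1)
  set g := fderiv ℝ f q.1
  set B := A.comp ((ContinuousLinearMap.fst ℝ (EuclideanSpace ℝ (Fin m)) ℝ).prod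
    (ContinuousLinearMap.snd ℝ (EuclideanSpace ℝ (Fin m)) ℝ
      + g.comp (ContinuousLinearMap.fst ℝ (EuclideanSpace ℝ (Fin m)) ℝ))) with hB
  have hlast : B (0, 1) = A (0, 1) := by simp [hB]
  have hfirst : A.comp (ContinuousLinearMap.inl ℝ (EuclideanSpace ℝ (Fin m)) ℝ) =
      B.comp (ContinuousLinearMap.inl ℝ (EuclideanSpace ℝ (Fin m)) ℝ) - B (0, 1) • g := by
    ext v
    have hv : ((v, g v) : EuclideanSpace ℝ (Fin m) × ℝ) = (v, 0) + g v • (0, 1) := by simp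
    have hAv : A (v, g v) = A (v, 0) + g v * A (0, 1) := by
      rw [hv, map_add, map_smul, smul_eq_mul]
    simp [hlast]
    simp [hB, hAv]
    ring
  rw [hfirst, ← hlast, add_sub_add_right_eq_sub]
  exact abs_norm_sub_smul_sq_sub_le hε _ g _ (hgrad q.1)

/-- Quantitative form of part (3) of Lemma 2.1: if `f` is `C¹` with `‖∇f‖ ≤ ε ≤ 1`
and `u` is `C¹` with compact support, then `ũ = u ∘ Φ⁻¹` (with the shear
`Φ(x', x_d) = (x', x_d − f(x'))`, so `ũ(y) = u(y', y_d + f(y'))`) is `C¹` with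
compact support and
`|∫ ‖∇u‖² − ∫ ‖∇ũ‖²| ≤ (2ε + ε²) ∫ ‖∇ũ‖²`.  Here `d = m + 1 ≥ 2`. -/
theorem shear_dirichlet_energy (m : ℕ) (hm : 1 ≤ m) (ε : ℝ)
    (hε0 : 0 ≤ ε) (hε1 : ε ≤ 1)
    (f : EuclideanSpace ℝ (Fin m) → ℝ) (hf : ContDiff ℝ 1 f)
    (hgrad : ∀ y, ‖fderiv ℝ f y‖ ≤ ε)
    (u : EuclideanSpace ℝ (Fin m) × ℝ → ℝ)
    (hu : ContDiff ℝ 1 u) (hsupp : HasCompactSupport u) :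
    ContDiff ℝ 1 (fun q : EuclideanSpace ℝ (Fin m) × ℝ => u (q.1, q.2 + f q.1)) ∧
    HasCompactSupport
      (fun q : EuclideanSpace ℝ (Fin m) × ℝ => u (q.1, q.2 + f q.1)) ∧
    |(∫ x, gradSq u x)
        - ∫ y, gradSq (fun q : EuclideanSpace ℝ (Fin m) × ℝ => u (q.1, q.2 + f q.1)) y|
      ≤ (2 * ε + ε ^ 2)
        * ∫ y, gradSq (fun q : EuclideanSpace ℝ (Fin m) × ℝ => u (q.1, q.2 + f q.1)) y := by
  have hΨ := measurePreserving_shearHomeomorph f hf.continuous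
  have hv : ContDiff ℝ 1 (fun q : EuclideanSpace ℝ (Fin m) × ℝ => u (q.1, q.2 + f q.1)) := by
    fun_prop
  have hvs : HasCompactSupport
      (fun q : EuclideanSpace ℝ (Fin m) × ℝ => u (q.1, q.2 + f q.1)) :=
    hsupp.comp_homeomorph (shearHomeomorph f hf.continuous)
  refine ⟨hv, hvs, ?_⟩
  have hemb := (shearHomeomorph f hf.continuous).measurableEmbedding
  have hiu : Integrable (fun q : EuclideanSpace ℝ (Fin m) × ℝ => gradSq u (q.1, q.2 + f q.1)) :=
    (hΨ.integrable_comp_emb hemb).2 (integrable_gradSq hu hsupp)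
  have hiv := integrable_gradSq hv hvs
  have hchange : ∫ x, gradSq u x =
      ∫ q : EuclideanSpace ℝ (Fin m) × ℝ, gradSq u (q.1, q.2 + f q.1) :=
    (hΨ.integral_comp hemb (gradSq u)).symm
  rw [hchange, ← integral_sub hiu hiv, ← integral_const_mul]
  rw [← Real.norm_eq_abs]
  exact norm_integral_le_of_norm_le (hiv.const_mul _) (Eventually.of_forall fun q =>
    abs_gradSq_sub_gradSq_comp_shear_le hε0 (hf.differentiable one_ne_zero) hgrad
      (hu.differentiable one_ne_zero) q)
end

section
/- Let d ≥ 2 be an integer, a ∈ ℝ, and t > 0. Then ∫₀¹ (1−ξ²)^{(d−1)/2} ξ cos(2ξt − a) dξ = (1/(2t)) ∫₀¹ (1−ξ²)^{(d−3)/2} (dξ² − 1) sin(2ξt − a) dξ. In particular, there is a constant C depending only on d such that |∫₀¹ (1−ξ²)^{(d−1)/2} ξ cos(2ξt − a) dξ| ≤ C/t for all t > 0 and all a ∈ ℝ. -/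
open MeasureTheory Filter Set Real

theorem integrableOn_one_sub_sq_rpow {s : ℝ} (hs : -1 < s) :
    IntegrableOn (fun x : ℝ => (1 - x ^ 2) ^ s) (Ioo 0 1) := by
  have h1 : IntegrableOn (fun x : ℝ => (1 - x) ^ s) (Icc 0 1) := by
    have h := (intervalIntegral.intervalIntegrable_rpow' (a := 1) (b := 0) hs).comp_sub_left 1
    rw [sub_self, sub_zero] at h
    exact (intervalIntegrable_iff_integrableOn_Icc_of_le zero_le_one enorm_ne_top).1 h
  have h2 : ContinuousOn (fun x : ℝ => (1 + x) ^ s) (Icc 0 1) :=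
    ContinuousOn.rpow_const (by fun_prop) fun x hx => Or.inl (by linarith [hx.1])
  refine ((h1.mul_continuousOn h2 isCompact_Icc).mono_set Ioo_subset_Icc_self).congr_fun
    (fun x hx => ?_) measurableSet_Ioo
  dsimp only
  rw [← mul_rpow (by linarith [hx.2]) (by linarith [hx.1])]
  ring_nf

theorem hasDerivAt_one_sub_sq_rpow_mul_sin (p a t : ℝ) {x : ℝ} (hx : x ∈ Ioo (0 : ℝ) 1) :
    HasDerivAt (fun ξ : ℝ => (1 - ξ ^ 2) ^ p * ξ * sin (2 * ξ * t - a))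
      (2 * t * ((1 - x ^ 2) ^ p * x * cos (2 * x * t - a))
        - (1 - x ^ 2) ^ (p - 1) * ((2 * p + 1) * x ^ 2 - 1) * sin (2 * x * t - a)) x := by
  have hpos : 0 < 1 - x ^ 2 := by nlinarith [hx.1, hx.2]
  have hbase : HasDerivAt (fun ξ : ℝ => 1 - ξ ^ 2) (-(2 * x)) x := by
    simpa using (hasDerivAt_pow 2 x).const_sub 1
  have hphase : HasDerivAt (fun ξ : ℝ => 2 * ξ * t - a) (2 * t) x := by
    simpa using (((hasDerivAt_id x).const_mul 2).mul_const t).sub_const a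
  have hrpow : (1 - x ^ 2) ^ p = (1 - x ^ 2) ^ (p - 1) * (1 - x ^ 2) := by
    rw [← rpow_add_one hpos.ne', sub_add_cancel]
  refine (((hbase.rpow_const (p := p) (Or.inl hpos.ne')).mul (hasDerivAt_id x)).mul
    hphase.sin).congr_deriv ?_
  simp only [id, Pi.mul_apply]
  rw [hrpow]
  ring

theorem integral_one_sub_sq_rpow_mul_cos {p : ℝ} (hp : 0 < p) (a : ℝ) {t : ℝ} (ht : 0 < t) :
    ∫ ξ in Ioo (0 : ℝ) 1, (1 - ξ ^ 2) ^ p * ξ * cos (2 * ξ * t - a)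
      = (1 / (2 * t)) * ∫ ξ in Ioo (0 : ℝ) 1,
          (1 - ξ ^ 2) ^ (p - 1) * ((2 * p + 1) * ξ ^ 2 - 1) * sin (2 * ξ * t - a) := by
  have hrpow : Continuous fun ξ : ℝ => (1 - ξ ^ 2) ^ p :=
    Continuous.rpow_const (by fun_prop) fun _ => Or.inr hp.le
  have hcos : IntegrableOn (fun ξ : ℝ => (1 - ξ ^ 2) ^ p * ξ * cos (2 * ξ * t - a)) (Ioo 0 1) :=
    (Continuous.integrableOn_Icc (by fun_prop)).mono_set Ioo_subset_Icc_self
  have hsin : IntegrableOn (fun ξ : ℝ => (1 - ξ ^ 2) ^ (p - 1) * ((2 * p + 1) * ξ ^ 2 - 1)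
      * sin (2 * ξ * t - a)) (Ioo 0 1) := by
    have h := integrableOn_one_sub_sq_rpow (s := p - 1) (by linarith)
    rw [← integrableOn_Icc_iff_integrableOn_Ioo] at h ⊢
    have hg : ContinuousOn (fun ξ : ℝ => ((2 * p + 1) * ξ ^ 2 - 1) * sin (2 * ξ * t - a))
        (Icc 0 1) := by fun_prop
    simpa only [mul_assoc] using h.mul_continuousOn hg isCompact_Icc
  have hftc := intervalIntegral.integral_eq_sub_of_hasDerivAt_of_le zero_le_one
    (f := fun ξ : ℝ => (1 - ξ ^ 2) ^ p * ξ * sin (2 * ξ * t - a)) (by fun_prop)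
    (fun x hx => hasDerivAt_one_sub_sq_rpow_mul_sin p a t hx)
    ((intervalIntegrable_iff_integrableOn_Ioo_of_le zero_le_one).2 ((hcos.const_mul _).sub hsin))
  rw [intervalIntegral.integral_of_le zero_le_one, integral_Ioc_eq_integral_Ioo,
    integral_sub (hcos.const_mul _) hsin, integral_const_mul] at hftc
  simp only [one_pow, sub_self, zero_rpow hp.ne', mul_zero, zero_mul] at hftc
  rw [← sub_eq_zero.1 hftc, one_div, inv_mul_cancel_left₀ (by positivity)]

theorem abs_integral_one_sub_sq_rpow_mul_sin_le {p : ℝ} (hp : 0 < p) (a t : ℝ) :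
    |∫ ξ in Ioo (0 : ℝ) 1, (1 - ξ ^ 2) ^ (p - 1) * ((2 * p + 1) * ξ ^ 2 - 1)
        * sin (2 * ξ * t - a)|
      ≤ (2 * p + 1) * ∫ ξ in Ioo (0 : ℝ) 1, (1 - ξ ^ 2) ^ (p - 1) := by
  rw [← integral_const_mul, ← Real.norm_eq_abs]
  refine norm_integral_le_of_norm_le
    ((integrableOn_one_sub_sq_rpow (s := p - 1) (by linarith)).const_mul (2 * p + 1)) ?_
  filter_upwards [ae_restrict_mem measurableSet_Ioo] with x hx
  have hsq : x ^ 2 ≤ 1 := by nlinarith [hx.1, hx.2]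
  have hw : 0 ≤ (1 - x ^ 2) ^ (p - 1) := rpow_nonneg (by linarith) _
  have hpoly : |(2 * p + 1) * x ^ 2 - 1| ≤ 2 * p + 1 := by
    rw [abs_le]
    constructor <;> nlinarith [sq_nonneg x]
  rw [Real.norm_eq_abs, abs_mul, abs_mul, abs_of_nonneg hw, mul_comm (2 * p + 1) ((1 - x ^ 2) ^ (p - 1))]
  exact (mul_le_of_le_one_right (by positivity) (abs_sin_le_one _)).trans
    (mul_le_mul_of_nonneg_left hpoly hw)

/-- The integration-by-parts identity and uniform oscillatory bound from the
proof of Lemma A.1: for `d ≥ 2`, `a ∈ ℝ`, `t > 0`,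
`∫₀¹ (1−ξ²)^{(d−1)/2} ξ cos(2ξt − a) dξ
  = (1/(2t)) ∫₀¹ (1−ξ²)^{(d−3)/2} (dξ² − 1) sin(2ξt − a) dξ`,
and in particular the left-hand side is bounded by `C/t` with `C` depending
only on `d`. -/
theorem oscillatory_integral_identity (d : ℕ) (hd : 2 ≤ d) :
    (∀ (a t : ℝ), 0 < t →
      ∫ ξ in Set.Ioo (0 : ℝ) 1,
          (1 - ξ ^ 2) ^ (((d : ℝ) - 1) / 2) * ξ * Real.cos (2 * ξ * t - a)
        = (1 / (2 * t)) * ∫ ξ in Set.Ioo (0 : ℝ) 1,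
            (1 - ξ ^ 2) ^ (((d : ℝ) - 3) / 2) * ((d : ℝ) * ξ ^ 2 - 1)
              * Real.sin (2 * ξ * t - a)) ∧
    ∃ C : ℝ, 0 < C ∧ ∀ (a t : ℝ), 0 < t →
      |∫ ξ in Set.Ioo (0 : ℝ) 1,
          (1 - ξ ^ 2) ^ (((d : ℝ) - 1) / 2) * ξ * Real.cos (2 * ξ * t - a)|
        ≤ C / t := by
  have hp : 0 < ((d : ℝ) - 1) / 2 := by
    have : (2 : ℝ) ≤ d := by exact_mod_cast hd
    linarith
  have hexp : ((d : ℝ) - 3) / 2 = ((d : ℝ) - 1) / 2 - 1 := by ring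
  have hcoef : (d : ℝ) = 2 * (((d : ℝ) - 1) / 2) + 1 := by ring
  generalize ((d : ℝ) - 1) / 2 = p at hp hexp hcoef ⊢
  rw [hexp, hcoef]
  refine ⟨fun a t ht => integral_one_sub_sq_rpow_mul_cos hp a ht, ?_⟩
  have hI : 0 ≤ ∫ ξ in Ioo (0 : ℝ) 1, (1 - ξ ^ 2) ^ (p - 1) :=
    setIntegral_nonneg measurableSet_Ioo fun x hx =>
      rpow_nonneg (by nlinarith [hx.1, hx.2]) _
  refine ⟨(2 * p + 1) * (∫ ξ in Ioo (0 : ℝ) 1, (1 - ξ ^ 2) ^ (p - 1)) + 1, by positivity,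
    fun a t ht => ?_⟩
  rw [integral_one_sub_sq_rpow_mul_cos hp a ht, abs_mul, abs_of_pos (by positivity),
    one_div_mul_eq_div]
  have hbound := abs_integral_one_sub_sq_rpow_mul_sin_le hp a t
  gcongr <;> linarith
end

section
/- Let d ≥ 2 be an integer, ν ≥ 0, and M ≥ 1. Let u, v : (0,∞) → ℝ satisfy the Bessel recurrence relations of order ν, with |u(s)| ≤ 1 and |v(s)| ≤ 1 for all s > 0, and suppose that for all s ≥ 1, |u(s) − √(2/(πs)) [cos(s − νπ/2 − π/4) − ((4ν² − 1)/(8s)) sin(s − νπ/2 − π/4)]| ≤ M s^{−5/2} and |v(s) − √(2/(πs)) [cos(s − (ν+1)π/2 − π/4) − ((4(ν+1)² − 1)/(8s)) sin(s − (ν+1)π/2 − π/4)]| ≤ M s^{−5/2}. Then there is a constant C depending only on d, ν, and M such that |P_u(t)| ≤ C t^{−2} for all t ≥ 1. -/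
open MeasureTheory Filter Set

/-- The function `P_u(t) = ∫₀¹ (1−ξ²)^{(d+1)/2} (1/π − ξ t u(ξt)²) dξ` of
Appendix A (with `u = J_ν` this is `P_ν`). -/
noncomputable def P (d : ℕ) (u : ℝ → ℝ) (t : ℝ) : ℝ :=
  ∫ ξ in Set.Ioo (0 : ℝ) 1,
    (1 - ξ ^ 2) ^ (((d : ℝ) + 1) / 2) * (1 / Real.pi - ξ * t * (u (ξ * t)) ^ 2)

/-- An antiderivative of `s ↦ 1 / π - s * u s ^ 2` (a Lommel integral) when `u, v` satisfy the
Bessel recurrence relations of order `ν`. -/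
noncomputable def lommelPrimitive (ν : ℝ) (u v : ℝ → ℝ) (s : ℝ) : ℝ :=
  s / Real.pi - (s ^ 2 * (u s ^ 2 + v s ^ 2) / 2 - ν * s * (u s * v s))

lemma hasDerivAt_lommelPrimitive {ν : ℝ} {u v : ℝ → ℝ} {x : ℝ} (hx : 0 < x)
    (hu : HasDerivAt u (ν / x * u x - v x) x)
    (hv : HasDerivAt v (u x - (ν + 1) / x * v x) x) :
    HasDerivAt (lommelPrimitive ν u v) (1 / Real.pi - x * u x ^ 2) x := by
  have h := ((hasDerivAt_id x).div_const Real.pi).sub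
    (((((hasDerivAt_id x).pow 2).mul ((hu.pow 2).add (hv.pow 2))).div_const 2).sub
      (((hasDerivAt_id x).const_mul ν).mul (hu.mul hv)))
  refine h.congr_deriv ?_
  simp
  field_simp
  ring

lemma abs_lommelPrimitive_le {ν : ℝ} (hν : 0 ≤ ν) {u v : ℝ → ℝ} {s : ℝ} (hs : 0 < s)
    (hs1 : s ≤ 1) (hu : |u s| ≤ 1) (hv : |v s| ≤ 1) :
    |lommelPrimitive ν u v s| ≤ (2 + ν) * s := by
  have hpi : 1 / Real.pi ≤ 1 := by
    rw [div_le_one Real.pi_pos]; linarith [Real.pi_gt_three]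
  have hpi0 : 0 < 1 / Real.pi := by positivity
  have hu2 : u s ^ 2 ≤ 1 := by rwa [sq_le_one_iff_abs_le_one]
  have hv2 : v s ^ 2 ≤ 1 := by rwa [sq_le_one_iff_abs_le_one]
  have huv : |u s * v s| ≤ 1 := by
    rw [abs_mul]; exact mul_le_one₀ hu (abs_nonneg _) hv
  have key : lommelPrimitive ν u v s
      = s * (1 / Real.pi - s * ((u s ^ 2 + v s ^ 2) / 2) + ν * (u s * v s)) := by
    unfold lommelPrimitive; ring
  rw [key, abs_mul, abs_of_pos hs, mul_comm]
  refine mul_le_mul_of_nonneg_right ?_ hs.le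
  have h1 : |ν * (u s * v s)| ≤ ν := by
    rw [abs_mul, abs_of_nonneg hν]; exact mul_le_of_le_one_right hν huv
  have h2 : s * ((u s ^ 2 + v s ^ 2) / 2) ≤ 1 := mul_le_one₀ hs1 (by positivity) (by linarith)
  have h3 : 0 ≤ s * ((u s ^ 2 + v s ^ 2) / 2) := by positivity
  rw [abs_le] at h1 ⊢
  constructor <;> linarith [h1.1, h1.2]

lemma continuousOn_lommelPrimitive {ν : ℝ} (hν : 0 ≤ ν) {u v : ℝ → ℝ}
    (hu : ∀ x > (0 : ℝ), HasDerivAt u (ν / x * u x - v x) x)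
    (hv : ∀ x > (0 : ℝ), HasDerivAt v (u x - (ν + 1) / x * v x) x)
    (hu1 : ∀ s > (0 : ℝ), |u s| ≤ 1) (hv1 : ∀ s > (0 : ℝ), |v s| ≤ 1) :
    ContinuousOn (lommelPrimitive ν u v) (Ici 0) := by
  intro x hx
  rcases (mem_Ici.1 hx).eq_or_lt with rfl | hx
  · have h0 : lommelPrimitive ν u v 0 = 0 := by simp [lommelPrimitive]
    rw [ContinuousWithinAt, h0]
    have hlim : Tendsto (fun s : ℝ => (2 + ν) * s) (nhdsWithin 0 (Ici 0)) (nhds 0) := by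
      have : Tendsto (fun s : ℝ => (2 + ν) * s) (nhds 0) (nhds ((2 + ν) * 0)) :=
        (continuous_const.mul continuous_id).tendsto 0
      rw [mul_zero] at this
      exact this.mono_left nhdsWithin_le_nhds
    refine squeeze_zero_norm' ?_ hlim
    filter_upwards [self_mem_nhdsWithin, mem_nhdsWithin_of_mem_nhds (Iic_mem_nhds one_pos)]
      with s hs hs1
    rcases (mem_Ici.1 hs).eq_or_lt with rfl | hs
    · simp [h0]
    · exact abs_lommelPrimitive_le hν hs hs1 (hu1 s hs) (hv1 s hs)
  · exact (hasDerivAt_lommelPrimitive hx (hu x hx) (hv x hx)).continuousAt.continuousWithinAt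

lemma abs_sqrt_mul_sub_le {M s y p : ℝ} (hs : 0 < s)
    (h : |y - Real.sqrt (2 / (Real.pi * s)) * p| ≤ M * s ^ (-(5 / 2 : ℝ))) :
    |s ^ 2 * (Real.sqrt s * y - Real.sqrt (2 / Real.pi) * p)| ≤ M := by
  have hr : 0 < Real.sqrt s := Real.sqrt_pos.2 hs
  have hA : Real.sqrt (2 / (Real.pi * s)) * Real.sqrt s = Real.sqrt (2 / Real.pi) := by
    rw [← div_div, Real.sqrt_div (by positivity)]
    field_simp
  have hpow : s ^ 2 * Real.sqrt s * s ^ (-(5 / 2 : ℝ)) = 1 := by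
    rw [Real.sqrt_eq_rpow, ← Real.rpow_natCast s 2, ← Real.rpow_add hs, ← Real.rpow_add hs]
    norm_num
  have key : s ^ 2 * (Real.sqrt s * y - Real.sqrt (2 / Real.pi) * p)
      = s ^ 2 * Real.sqrt s * (y - Real.sqrt (2 / (Real.pi * s)) * p) := by
    rw [← hA]; ring
  rw [key, abs_mul, abs_of_pos (by positivity)]
  calc s ^ 2 * Real.sqrt s * |y - Real.sqrt (2 / (Real.pi * s)) * p|
      ≤ s ^ 2 * Real.sqrt s * (M * s ^ (-(5 / 2 : ℝ))) := by gcongr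
    _ = M * (s ^ 2 * Real.sqrt s * s ^ (-(5 / 2 : ℝ))) := by ring
    _ = M := by rw [hpow, mul_one]

lemma exists_abs_lommelPrimitive_add_le (ν M : ℝ) (hν : 0 ≤ ν) :
    ∃ K : ℝ, 0 ≤ K ∧ ∀ u v : ℝ → ℝ,
      (∀ s > (0 : ℝ), |u s| ≤ 1) → (∀ s > (0 : ℝ), |v s| ≤ 1) →
      (∀ s ≥ (1 : ℝ),
        |u s - Real.sqrt (2 / (Real.pi * s)) *
            (Real.cos (s - ν * Real.pi / 2 - Real.pi / 4)
              - (4 * ν ^ 2 - 1) / (8 * s)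
                * Real.sin (s - ν * Real.pi / 2 - Real.pi / 4))|
          ≤ M * s ^ (-(5 / 2 : ℝ))) →
      (∀ s ≥ (1 : ℝ),
        |v s - Real.sqrt (2 / (Real.pi * s)) *
            (Real.cos (s - (ν + 1) * Real.pi / 2 - Real.pi / 4)
              - (4 * (ν + 1) ^ 2 - 1) / (8 * s)
                * Real.sin (s - (ν + 1) * Real.pi / 2 - Real.pi / 4))|
          ≤ M * s ^ (-(5 / 2 : ℝ))) →
      ∀ s > (0 : ℝ), |lommelPrimitive ν u v s
        + Real.sin (2 * (s - (ν * Real.pi / 2 + Real.pi / 4))) / (2 * Real.pi)| ≤ K / s := by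
  set α : ℝ := (4 * ν ^ 2 - 1) / 8 with hα
  set β : ℝ := (4 * (ν + 1) ^ 2 - 1) / 8 with hβ
  set k : ℝ := Real.sqrt (2 / Real.pi) with hk
  have hk2 : k ^ 2 = 2 / Real.pi := Real.sq_sqrt (by positivity)
  let R : ℝ × ℝ × ℝ × ℝ × ℝ → ℝ := fun z =>
    let x := z.1; let c := z.2.1; let w := z.2.2.1; let a := z.2.2.2.1; let b := z.2.2.2.2;
    -(α ^ 2 * w ^ 2 + β ^ 2 * c ^ 2) * (1 / Real.pi)
      - (k * (c - α * x * w) * a + x ^ 2 * a ^ 2 / 2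
        + k * (w + β * x * c) * b + x ^ 2 * b ^ 2 / 2)
      + ν * (2 * (1 / Real.pi) * (β * c ^ 2 - α * w ^ 2 - α * β * x * w * c)
        + k * (c - α * x * w) * x * b + k * (w + β * x * c) * x * a + x ^ 3 * a * b)
  have hR : Continuous R := by
    dsimp only [R]
    fun_prop
  obtain ⟨K, hK⟩ := ((isCompact_Icc (a := (0 : ℝ)) (b := 1)).prod
    ((isCompact_Icc (a := (-1 : ℝ)) (b := 1)).prod
    ((isCompact_Icc (a := (-1 : ℝ)) (b := 1)).prod
    ((isCompact_Icc (a := -M) (b := M)).prod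
    (isCompact_Icc (a := -M) (b := M)))))).exists_bound_of_continuousOn hR.continuousOn
  refine ⟨max K (3 + ν), le_max_of_le_right (by linarith), ?_⟩
  intro u v hu1 hv1 hu hv s hs
  have hpi : 1 / Real.pi ≤ 1 := by
    rw [div_le_one Real.pi_pos]; linarith [Real.pi_gt_three]
  rcases le_total s 1 with hs1 | hs1
  · have h1 := abs_lommelPrimitive_le hν hs hs1 (hu1 s hs) (hv1 s hs)
    have h2 : |Real.sin (2 * (s - (ν * Real.pi / 2 + Real.pi / 4))) / (2 * Real.pi)| ≤ 1 := by
      rw [abs_div, abs_of_pos (by positivity : (0 : ℝ) < 2 * Real.pi),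
        div_le_one (by positivity)]
      linarith [Real.abs_sin_le_one (2 * (s - (ν * Real.pi / 2 + Real.pi / 4))),
        Real.pi_gt_three]
    have h3 : (2 + ν) * s ≤ 2 + ν := mul_le_of_le_one_right (by linarith) hs1
    calc _ ≤ _ := abs_add_le _ _
      _ ≤ 3 + ν := by linarith
      _ ≤ max K (3 + ν) := le_max_right _ _
      _ ≤ max K (3 + ν) / s :=
        le_div_self (le_max_of_le_right (by linarith)) hs hs1
  · set θ : ℝ := s - (ν * Real.pi / 2 + Real.pi / 4) with hθ
    have hU := abs_sqrt_mul_sub_le hs (hu s hs1)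
    have hV := abs_sqrt_mul_sub_le hs (hv s hs1)
    rw [show s - ν * Real.pi / 2 - Real.pi / 4 = θ by rw [hθ]; ring] at hU
    rw [show s - (ν + 1) * Real.pi / 2 - Real.pi / 4 = θ - Real.pi / 2 by rw [hθ]; ring,
      Real.cos_sub_pi_div_two, Real.sin_sub_pi_div_two] at hV
    rw [Real.sin_two_mul]
    have htrig := Real.sin_sq_add_cos_sq θ
    have hc := Real.abs_cos_le_one θ
    have hw := Real.abs_sin_le_one θ
    generalize Real.cos θ = c at *
    generalize Real.sin θ = w at *
    set x : ℝ := 1 / s with hx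
    have hsx : s * x = 1 := by rw [hx]; field_simp
    have hx0 : 0 ≤ x := by positivity
    have hx1 : x ≤ 1 := by rw [hx, div_le_one hs]; exact hs1
    rw [← hk, show (4 * ν ^ 2 - 1) / (8 * s) = α * x by rw [hα, hx]; field_simp] at hU
    rw [← hk, show (4 * (ν + 1) ^ 2 - 1) / (8 * s) = β * x by rw [hβ, hx]; field_simp] at hV
    set a : ℝ := s ^ 2 * (Real.sqrt s * u s - k * (c - α * x * w)) with ha
    set b : ℝ := s ^ 2 * (Real.sqrt s * v s - k * (w - β * x * -c)) with hb
    have hmem := hK (x, c, w, a, b)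
      ⟨⟨hx0, hx1⟩, abs_le.1 hc, abs_le.1 hw, abs_le.1 hU, abs_le.1 hV⟩
    have hsx2 : x ^ 2 * s ^ 2 = 1 := by rw [← mul_pow, mul_comm, hsx, one_pow]
    have hUa : Real.sqrt s * u s = k * (c - α * x * w) + x ^ 2 * a := by
      rw [ha, ← mul_assoc, hsx2]; ring
    have hVb : Real.sqrt s * v s = k * (w + β * x * c) + x ^ 2 * b := by
      rw [hb, ← mul_assoc, hsx2]; ring
    have hαβ : β - α = ν + 1 / 2 := by rw [hα, hβ]; ring
    have hsq : Real.sqrt s ^ 2 = s := Real.sq_sqrt hs.le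
    have hF : lommelPrimitive ν u v s = s * (1 / Real.pi)
        - s * ((Real.sqrt s * u s) ^ 2 + (Real.sqrt s * v s) ^ 2) / 2
        + ν * ((Real.sqrt s * u s) * (Real.sqrt s * v s)) := by
      unfold lommelPrimitive
      linear_combination (s * (u s ^ 2 + v s ^ 2) / 2 - ν * (u s * v s)) * hsq
    have key : lommelPrimitive ν u v s + 2 * w * c / (2 * Real.pi) = x * R (x, c, w, a, b) := by
      rw [hF, hUa, hVb, show 2 * w * c / (2 * Real.pi) = w * c * (1 / Real.pi) by field_simp]
      rw [show 2 / Real.pi = 2 * (1 / Real.pi) by ring] at hk2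
      dsimp only [R]
      generalize 1 / Real.pi = i at *
      clear_value α β k x a b
      linear_combination (-s * ((c - α * x * w) ^ 2 + (w + β * x * c) ^ 2) / 2
          + ν * (c - α * x * w) * (w + β * x * c)) * hk2
        + (-s * i) * htrig + (-2 * i * w * c) * hαβ
        + (-2 * i * (β - α) * w * c - x * i * (α ^ 2 * w ^ 2 + β ^ 2 * c ^ 2)
          - (k * (c - α * x * w) * x * a + x ^ 3 * a ^ 2 / 2
            + k * (w + β * x * c) * x * b + x ^ 3 * b ^ 2 / 2)) * hsx
    rw [key, abs_mul, abs_of_nonneg hx0, mul_comm, div_eq_mul_one_div, ← hx]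
    exact mul_le_mul_of_nonneg_right (hmem.trans (le_max_left _ _)) hx0

lemma hasDerivAt_one_sub_sq_rpow {p x : ℝ} (h : 1 - x ^ 2 ≠ 0 ∨ 1 ≤ p) :
    HasDerivAt (fun ξ : ℝ => (1 - ξ ^ 2) ^ p) (-(2 * p) * (x * (1 - x ^ 2) ^ (p - 1))) x := by
  have h1 : HasDerivAt (fun ξ : ℝ => 1 - ξ ^ 2) (-(2 * x)) x := by
    simpa using ((hasDerivAt_id x).pow 2).const_sub 1
  refine (h1.rpow_const h).congr_deriv ?_
  ring

lemma continuous_one_sub_sq_rpow {p : ℝ} (hp : 0 ≤ p) :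
    Continuous fun ξ : ℝ => (1 - ξ ^ 2) ^ p :=
  (by fun_prop : Continuous fun ξ : ℝ => 1 - ξ ^ 2).rpow_const fun _ => Or.inr hp

lemma one_sub_sq_pos {x : ℝ} (hx : x ∈ Ioo (0 : ℝ) 1) : 0 < 1 - x ^ 2 := by
  nlinarith [hx.1, hx.2]

lemma intervalIntegrable_mul_one_sub_sq_rpow {b : ℝ} (hb : 0 < b) :
    IntervalIntegrable (fun ξ : ℝ => ξ * (1 - ξ ^ 2) ^ (b - 1)) volume 0 1 := by
  have h : IntervalIntegrable (fun ξ : ℝ => (2 * b) * (ξ * (1 - ξ ^ 2) ^ (b - 1))) volume 0 1 := by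
    refine intervalIntegral.intervalIntegrable_deriv_of_nonneg
      (g := fun ξ : ℝ => -(1 - ξ ^ 2) ^ b)
      (continuous_one_sub_sq_rpow hb.le).neg.continuousOn ?_ ?_
    · intro x hx
      simp only [zero_le_one, min_eq_left, max_eq_right] at hx
      exact (hasDerivAt_one_sub_sq_rpow (p := b) (Or.inl (one_sub_sq_pos hx).ne')).neg.congr_deriv
        (by ring)
    · intro x hx
      simp only [zero_le_one, min_eq_left, max_eq_right] at hx
      have := one_sub_sq_pos hx
      have := hx.1
      positivity
  convert h.const_mul (2 * b)⁻¹ using 2 with ξ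
  field_simp

lemma exists_abs_integral_mul_sin_le {b : ℝ} (hb : 0 < b) :
    ∃ D : ℝ, 0 ≤ D ∧ ∀ t c : ℝ, 0 < t →
      |∫ ξ in (0 : ℝ)..1, ξ * (1 - ξ ^ 2) ^ b * Real.sin (2 * (ξ * t - c))| ≤ D / t := by
  set g' : ℝ → ℝ := fun ξ => (1 - ξ ^ 2) ^ b + ξ * (-(2 * b) * (ξ * (1 - ξ ^ 2) ^ (b - 1)))
    with hg'
  have hint : IntervalIntegrable g' volume 0 1 :=
    ((continuous_one_sub_sq_rpow hb.le).intervalIntegrable 0 1).add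
      (((intervalIntegrable_mul_one_sub_sq_rpow hb).const_mul _).continuousOn_mul
        continuousOn_id)
  refine ⟨∫ ξ in (0 : ℝ)..1, |g' ξ|,
    intervalIntegral.integral_nonneg zero_le_one fun _ _ => abs_nonneg _, fun t c ht => ?_⟩
  have hcos : ∀ x : ℝ, HasDerivAt (fun ξ : ℝ => -Real.cos (2 * (ξ * t - c)) / (2 * t))
      (Real.sin (2 * (x * t - c))) x := by
    intro x
    have h1 : HasDerivAt (fun ξ : ℝ => 2 * (ξ * t - c)) (2 * t) x := by
      simpa using (((hasDerivAt_id x).mul_const t).sub_const c).const_mul 2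
    refine (h1.cos.neg.div_const (2 * t)).congr_deriv ?_
    field_simp
  have hparts := intervalIntegral.integral_mul_deriv_eq_deriv_mul_of_hasDerivAt
    (a := 0) (b := 1) (u := fun ξ : ℝ => ξ * (1 - ξ ^ 2) ^ b)
    (v := fun ξ : ℝ => -Real.cos (2 * (ξ * t - c)) / (2 * t))
    (u' := g') (v' := fun ξ => Real.sin (2 * (ξ * t - c)))
    (continuous_id.mul (continuous_one_sub_sq_rpow hb.le)).continuousOn
    (by fun_prop)
    (fun x hx => by
      simp only [zero_le_one, min_eq_left, max_eq_right] at hx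
      exact ((hasDerivAt_id x).mul
        (hasDerivAt_one_sub_sq_rpow (Or.inl (one_sub_sq_pos hx).ne'))).congr_deriv
          (by simp [hg']))
    (fun x _ => hcos x) hint
    (Continuous.intervalIntegrable (by fun_prop) _ _)
  rw [hparts]
  have h0 : ((1 : ℝ) - 1 ^ 2) ^ b = 0 := by
    rw [one_pow, sub_self, Real.zero_rpow hb.ne']
  simp only [h0, mul_zero, zero_mul, sub_zero, zero_sub, abs_neg]
  rw [← intervalIntegral.integral_div, ← Real.norm_eq_abs]
  refine intervalIntegral.norm_integral_le_of_norm_le zero_le_one ?_ (hint.abs.div_const t)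
  refine Eventually.of_forall fun x _ => ?_
  rw [Real.norm_eq_abs, abs_mul, div_eq_mul_one_div |g' x|]
  refine mul_le_mul_of_nonneg_left ?_ (abs_nonneg _)
  rw [abs_div, abs_neg, abs_of_pos (by positivity : 0 < 2 * t)]
  exact div_le_div₀ zero_le_one (Real.abs_cos_le_one _) ht (by linarith)

/-- Lemma A.1 of the paper: if `u, v` satisfy the Bessel recurrence relations of
order `ν ≥ 0`, are bounded by `1`, and obey the standard large-argument
asymptotic expansions of `J_ν`, `J_{ν+1}` with error constant `M`, then
`|P_u(t)| ≤ C t⁻²` for `t ≥ 1`, with `C` depending only on `d`, `ν`, `M`. -/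
theorem P_decay (d : ℕ) (hd : 2 ≤ d) (ν M : ℝ) (hν : 0 ≤ ν) (hM : 1 ≤ M) :
    ∃ C : ℝ, 0 < C ∧
      ∀ u v : ℝ → ℝ,
        (∀ x > (0 : ℝ), HasDerivAt u (ν / x * u x - v x) x) →
        (∀ x > (0 : ℝ), HasDerivAt v (u x - (ν + 1) / x * v x) x) →
        (∀ s > (0 : ℝ), |u s| ≤ 1) → (∀ s > (0 : ℝ), |v s| ≤ 1) →
        (∀ s ≥ (1 : ℝ),
          |u s - Real.sqrt (2 / (Real.pi * s)) *
              (Real.cos (s - ν * Real.pi / 2 - Real.pi / 4)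
                - (4 * ν ^ 2 - 1) / (8 * s)
                  * Real.sin (s - ν * Real.pi / 2 - Real.pi / 4))|
            ≤ M * s ^ (-(5 / 2 : ℝ))) →
        (∀ s ≥ (1 : ℝ),
          |v s - Real.sqrt (2 / (Real.pi * s)) *
              (Real.cos (s - (ν + 1) * Real.pi / 2 - Real.pi / 4)
                - (4 * (ν + 1) ^ 2 - 1) / (8 * s)
                  * Real.sin (s - (ν + 1) * Real.pi / 2 - Real.pi / 4))|
            ≤ M * s ^ (-(5 / 2 : ℝ))) →
        ∀ t ≥ (1 : ℝ), |P d u t| ≤ C / t ^ 2 := by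
  set a : ℝ := ((d : ℝ) + 1) / 2 with ha
  have hd' : (2 : ℝ) ≤ d := by exact_mod_cast hd
  have hb : 0 < a - 1 := by rw [ha]; linarith
  obtain ⟨K, hK0, hK⟩ := exists_abs_lommelPrimitive_add_le ν M hν
  obtain ⟨D, hD0, hD⟩ := exists_abs_integral_mul_sin_le hb
  refine ⟨2 * a * (K + D) + 1, by positivity, ?_⟩
  intro u v hu hv hu1 hv1 hua hva t ht
  have ht0 : 0 < t := by linarith
  set F := lommelPrimitive ν u v with hF
  set c : ℝ := ν * Real.pi / 2 + Real.pi / 4 with hc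
  have hFK : ∀ s > (0 : ℝ), |F s + Real.sin (2 * (s - c)) / (2 * Real.pi)| ≤ K / s :=
    hK u v hu1 hv1 hua hva
  have hFcont : ContinuousOn (fun ξ => F (ξ * t)) (Icc 0 1) :=
    (continuousOn_lommelPrimitive hν hu hv hu1 hv1).comp (by fun_prop)
      fun x hx => mul_nonneg hx.1 ht0.le
  have hgcont : Continuous fun ξ : ℝ => ξ * (1 - ξ ^ 2) ^ (a - 1) :=
    continuous_id.mul (continuous_one_sub_sq_rpow hb.le)
  have hFint : IntervalIntegrable (fun ξ => 1 / Real.pi - ξ * t * u (ξ * t) ^ 2) volume 0 1 := by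
    rw [intervalIntegrable_iff_integrableOn_Ioo_of_le zero_le_one]
    have hucont : ContinuousOn (fun ξ => u (ξ * t)) (Ioo 0 1) := fun x hx =>
      (ContinuousAt.comp (f := fun ξ => ξ * t) (hu _ (mul_pos hx.1 ht0)).continuousAt
        (by fun_prop)).continuousWithinAt
    refine Integrable.of_bound
      (ContinuousOn.aestronglyMeasurable (continuousOn_const.sub
        ((by fun_prop : ContinuousOn (fun ξ => ξ * t) (Ioo 0 1)).mul (hucont.pow 2)))
        measurableSet_Ioo) (1 / Real.pi + t) ?_
    refine (ae_restrict_iff' measurableSet_Ioo).2 (Eventually.of_forall fun x hx => ?_)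
    have h1 : u (x * t) ^ 2 ≤ 1 := (sq_le_one_iff_abs_le_one _).2 (hu1 _ (mul_pos hx.1 ht0))
    have h2 : x * t * u (x * t) ^ 2 ≤ t := by
      calc x * t * u (x * t) ^ 2 ≤ 1 * t * 1 := by
            gcongr
            exact hx.2.le
        _ = t := by ring
    have h3 : 0 ≤ x * t * u (x * t) ^ 2 :=
      mul_nonneg (mul_pos hx.1 ht0).le (sq_nonneg _)
    have h4 : 0 < 1 / Real.pi := by positivity
    rw [Real.norm_eq_abs, abs_le]
    constructor <;> linarith
  have hparts : P d u t = 2 * a / t *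
      ∫ ξ in (0 : ℝ)..1, ξ * (1 - ξ ^ 2) ^ (a - 1) * F (ξ * t) := by
    have h := intervalIntegral.integral_mul_deriv_eq_deriv_mul_of_hasDerivAt
      (a := 0) (b := 1) (u := fun ξ : ℝ => (1 - ξ ^ 2) ^ a) (v := fun ξ : ℝ => F (ξ * t) / t)
      (u' := fun ξ => -(2 * a) * (ξ * (1 - ξ ^ 2) ^ (a - 1)))
      (v' := fun ξ => 1 / Real.pi - ξ * t * u (ξ * t) ^ 2)
      (continuous_one_sub_sq_rpow (by linarith)).continuousOn
      (by rw [uIcc_of_le zero_le_one]; exact hFcont.div_const t)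
      (fun x _ => hasDerivAt_one_sub_sq_rpow (Or.inr (by linarith)))
      (fun x hx => by
        simp only [zero_le_one, min_eq_left, max_eq_right] at hx
        have hxt := mul_pos hx.1 ht0
        have h1 : HasDerivAt (fun ξ : ℝ => ξ * t) t x := by
          simpa using (hasDerivAt_id x).mul_const t
        refine (((hasDerivAt_lommelPrimitive hxt (hu _ hxt) (hv _ hxt)).comp x h1).div_const
          t).congr_deriv ?_
        field_simp)
      ((hgcont.const_mul _).intervalIntegrable 0 1) hFint
    have hF0 : F (0 * t) = 0 := by simp [hF, lommelPrimitive]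
    have h0 : ((1 : ℝ) - 1 ^ 2) ^ a = 0 := by
      rw [one_pow, sub_self, Real.zero_rpow (by linarith)]
    rw [h0, hF0, zero_mul, zero_div, mul_zero, sub_zero, zero_sub] at h
    rw [P, ← integral_Ioc_eq_integral_Ioo, ← intervalIntegral.integral_of_le zero_le_one, h,
      ← intervalIntegral.integral_neg, ← intervalIntegral.integral_const_mul]
    refine intervalIntegral.integral_congr fun x _ => ?_
    ring
  have hsplit : ∫ ξ in (0 : ℝ)..1, ξ * (1 - ξ ^ 2) ^ (a - 1) * F (ξ * t)
      = (∫ ξ in (0 : ℝ)..1, ξ * (1 - ξ ^ 2) ^ (a - 1)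
          * (F (ξ * t) + Real.sin (2 * (ξ * t - c)) / (2 * Real.pi)))
        - (∫ ξ in (0 : ℝ)..1, ξ * (1 - ξ ^ 2) ^ (a - 1) * Real.sin (2 * (ξ * t - c)))
          / (2 * Real.pi) := by
    rw [← intervalIntegral.integral_div, ← intervalIntegral.integral_sub]
    · refine intervalIntegral.integral_congr fun x _ => ?_
      ring
    · refine ContinuousOn.intervalIntegrable ?_
      rw [uIcc_of_le zero_le_one]
      exact hgcont.continuousOn.mul (hFcont.add (by fun_prop))
    · exact ((hgcont.mul (by fun_prop)).div_const _).intervalIntegrable 0 1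
  have hI1 : |∫ ξ in (0 : ℝ)..1, ξ * (1 - ξ ^ 2) ^ (a - 1)
      * (F (ξ * t) + Real.sin (2 * (ξ * t - c)) / (2 * Real.pi))| ≤ K / t := by
    rw [← Real.norm_eq_abs]
    refine (intervalIntegral.norm_integral_le_of_norm_le_const (C := K / t) fun x hx => ?_).trans
      (by simp)
    rw [uIoc_of_le zero_le_one] at hx
    have hx0 := hx.1
    have h1 : 0 ≤ 1 - x ^ 2 := by nlinarith [hx.1, hx.2]
    have h2 : (1 - x ^ 2) ^ (a - 1) ≤ 1 :=
      Real.rpow_le_one h1 (by linarith [sq_nonneg x]) hb.le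
    have h3 : 0 ≤ (1 - x ^ 2) ^ (a - 1) := Real.rpow_nonneg h1 _
    rw [Real.norm_eq_abs, abs_mul, abs_of_nonneg (mul_nonneg hx.1.le h3)]
    calc _ ≤ x * 1 * (K / (x * t)) := by
          gcongr
          exact hFK _ (mul_pos hx.1 ht0)
      _ = K / t := by field_simp
  have hI2 : |(∫ ξ in (0 : ℝ)..1, ξ * (1 - ξ ^ 2) ^ (a - 1) * Real.sin (2 * (ξ * t - c)))
      / (2 * Real.pi)| ≤ D / t := by
    rw [abs_div, abs_of_pos (by positivity : 0 < 2 * Real.pi)]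
    exact (div_le_self (abs_nonneg _) (by linarith [Real.pi_gt_three])).trans (hD t c ht0)
  have ha0 : 0 < 2 * a / t := div_pos (by linarith) ht0
  rw [hparts, hsplit, abs_mul, abs_of_pos ha0]
  calc _ ≤ 2 * a / t * (K / t + D / t) :=
        mul_le_mul_of_nonneg_left ((abs_sub _ _).trans (add_le_add hI1 hI2)) ha0.le
    _ = 2 * a * (K + D) / t ^ 2 := by field_simp
    _ ≤ (2 * a * (K + D) + 1) / t ^ 2 := by gcongr; linarith
end

section
/- Let d ≥ 1 be an integer and ν ∈ ℝ. Let u, v : (0,∞) → ℝ be continuous, bounded, satisfy the Bessel recurrence relations of order ν, and assume x²(u(x)² + v(x)²) → 0 and x u(x) v(x) → 0 as x → 0⁺. Then for every T > 0, ∫₀^T P_u(t) dt = (T/2)(P_u(T) + P_v(T)) + ν ∫₀^T (1 − s²/T²)^{(d+1)/2} u(s) v(s) ds. -/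
open MeasureTheory Filter Set

/-- Antiderivative of `x u(x)²` for a solution of the Bessel recurrence relations (Lommel). -/
theorem hasDerivAt_lommel {ν : ℝ} {u v : ℝ → ℝ} {x : ℝ} (hx : 0 < x)
    (hu : HasDerivAt u (ν / x * u x - v x) x)
    (hv : HasDerivAt v (u x - (ν + 1) / x * v x) x) :
    HasDerivAt (fun x => x ^ 2 * (u x ^ 2 + v x ^ 2) / 2 - ν * (x * u x * v x))
      (x * u x ^ 2) x := by
  have hsq : HasDerivAt (fun x : ℝ => x ^ 2) (2 * x) x := by
    simpa using hasDerivAt_pow 2 x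
  have h := ((hsq.mul ((hu.pow 2).add (hv.pow 2))).div_const 2).sub
    ((((hasDerivAt_id x).mul hu).mul hv).const_mul ν)
  refine h.congr_deriv ?_
  simp only [Pi.add_apply, Pi.pow_apply, Pi.mul_apply, id]
  field_simp
  push_cast
  ring

theorem integrableOn_of_continuousOn_of_bound {X : Type*} [TopologicalSpace X]
    [MeasurableSpace X] [OpensMeasurableSpace X] [SecondCountableTopology X] {μ : Measure X}
    {f : X → ℝ} {s : Set X} (hs : MeasurableSet s) (hμ : μ s < ⊤) (hf : ContinuousOn f s)
    (C : ℝ) (hC : ∀ x ∈ s, |f x| ≤ C) : IntegrableOn f s μ :=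
  IntegrableOn.of_bound hμ (hf.aestronglyMeasurable hs) C
    ((ae_restrict_iff' hs).2 (Eventually.of_forall hC))

theorem integral_Ioc_eq_lommel {ν : ℝ} {u v : ℝ → ℝ} (hu_cont : ContinuousOn u (Set.Ioi 0))
    (hu_bdd : ∃ M : ℝ, ∀ x > (0 : ℝ), |u x| ≤ M)
    (hu : ∀ x > (0 : ℝ), HasDerivAt u (ν / x * u x - v x) x)
    (hv : ∀ x > (0 : ℝ), HasDerivAt v (u x - (ν + 1) / x * v x) x)
    (hlim1 : Tendsto (fun x => x ^ 2 * ((u x) ^ 2 + (v x) ^ 2))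
      (nhdsWithin 0 (Set.Ioi 0)) (nhds 0))
    (hlim2 : Tendsto (fun x => x * u x * v x) (nhdsWithin 0 (Set.Ioi 0)) (nhds 0))
    {x : ℝ} (hx : 0 < x) :
    ∫ s in Set.Ioc 0 x, s * u s ^ 2 =
      x ^ 2 * (u x ^ 2 + v x ^ 2) / 2 - ν * (x * u x * v x) := by
  obtain ⟨M, hM⟩ := hu_bdd
  have hint : IntegrableOn (fun s => s * u s ^ 2) (Set.Ioc 0 x) := by
    refine integrableOn_of_continuousOn_of_bound measurableSet_Ioc (by simp)
      (continuousOn_id.mul ((hu_cont.mono fun s hs => hs.1).pow 2)) (x * M ^ 2) ?_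
    intro s hs
    rw [abs_mul, abs_pow, abs_of_pos hs.1]
    have := hM s hs.1
    gcongr
    exact hs.2
  have hd : ∀ y > 0, HasDerivAt
      (fun x => x ^ 2 * (u x ^ 2 + v x ^ 2) / 2 - ν * (x * u x * v x)) (y * u y ^ 2) y :=
    fun y hy => hasDerivAt_lommel hy (hu y hy) (hv y hy)
  rw [← intervalIntegral.integral_of_le hx.le,
    intervalIntegral.integral_eq_sub_of_hasDerivAt_of_tendsto hx (fun y hy => hd y hy.1)
      ((intervalIntegrable_iff_integrableOn_Ioc_of_le hx.le).2 hint) (fa := 0) ?_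
      ((hd x hx).continuousAt.tendsto.mono_left nhdsWithin_le_nhds), sub_zero]
  simpa using (hlim1.div_const 2).sub (hlim2.const_mul ν)

theorem integral_Ioc_comp_mul {g : ℝ → ℝ} {c T : ℝ} (hc : 0 < c) (hT : 0 < T) :
    ∫ t in Set.Ioc 0 T, g (c * t) = c⁻¹ * ∫ s in Set.Ioc 0 (c * T), g s := by
  rw [← intervalIntegral.integral_of_le hT.le,
    ← intervalIntegral.integral_of_le (mul_pos hc hT).le,
    intervalIntegral.integral_comp_mul_left _ hc.ne', mul_zero, smul_eq_mul]

/-- The main computation in the proof of Lemma A.2: if `u, v` are continuous,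
bounded, satisfy the Bessel recurrence relations of order `ν`, and
`x²(u² + v²) → 0`, `x u v → 0` as `x → 0⁺`, then for every `T > 0`,
`∫₀^T P_u(t) dt = (T/2)(P_u(T) + P_v(T)) + ν ∫₀^T (1 − s²/T²)^{(d+1)/2} u(s) v(s) ds`. -/
theorem P_integral_identity (d : ℕ) (hd : 1 ≤ d) (ν : ℝ) (u v : ℝ → ℝ)
    (hu_cont : ContinuousOn u (Set.Ioi 0)) (hv_cont : ContinuousOn v (Set.Ioi 0))
    (hu_bdd : ∃ M : ℝ, ∀ x > (0 : ℝ), |u x| ≤ M)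
    (hv_bdd : ∃ M : ℝ, ∀ x > (0 : ℝ), |v x| ≤ M)
    (hu : ∀ x > (0 : ℝ), HasDerivAt u (ν / x * u x - v x) x)
    (hv : ∀ x > (0 : ℝ), HasDerivAt v (u x - (ν + 1) / x * v x) x)
    (hlim1 : Tendsto (fun x => x ^ 2 * ((u x) ^ 2 + (v x) ^ 2))
      (nhdsWithin 0 (Set.Ioi 0)) (nhds 0))
    (hlim2 : Tendsto (fun x => x * u x * v x) (nhdsWithin 0 (Set.Ioi 0)) (nhds 0)) :
    ∀ T > (0 : ℝ),
      ∫ t in Set.Ioc (0 : ℝ) T, P d u t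
        = T / 2 * (P d u T + P d v T)
          + ν * ∫ s in Set.Ioc (0 : ℝ) T,
              (1 - s ^ 2 / T ^ 2) ^ (((d : ℝ) + 1) / 2) * (u s * v s) := by
  intro T hT
  have hF : ∀ x > 0, ∫ s in Set.Ioc 0 x, s * u s ^ 2 =
      x ^ 2 * (u x ^ 2 + v x ^ 2) / 2 - ν * (x * u x * v x) :=
    fun x hx => integral_Ioc_eq_lommel hu_cont hu_bdd hu hv hlim1 hlim2 hx
  obtain ⟨M, hM⟩ := hu_bdd
  obtain ⟨N, hN⟩ := hv_bdd
  set a : ℝ := ((d : ℝ) + 1) / 2 with ha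
  have ha0 : 0 ≤ a := by positivity
  have hw_cont : Continuous fun ξ : ℝ => (1 - ξ ^ 2) ^ a :=
    (continuous_const.sub (continuous_pow 2)).rpow_const fun _ => Or.inr ha0
  have hw : ∀ ξ ∈ Set.Ioo (0 : ℝ) 1, |(1 - ξ ^ 2) ^ a| ≤ 1 := by
    intro ξ hξ
    have h0 : 0 ≤ 1 - ξ ^ 2 := by nlinarith [hξ.1, hξ.2]
    rw [abs_of_nonneg (Real.rpow_nonneg h0 a)]
    exact Real.rpow_le_one h0 (by nlinarith [hξ.1]) ha0
  have hbound : ∀ (f : ℝ → ℝ) (K : ℝ), (∀ x > 0, |f x| ≤ K) → ∀ t ∈ Set.Ioc 0 T,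
      ∀ ξ ∈ Set.Ioo (0 : ℝ) 1,
      |(1 - ξ ^ 2) ^ a * (1 / Real.pi - ξ * t * f (ξ * t) ^ 2)|
        ≤ 1 / Real.pi + T * K ^ 2 := by
    intro f K hK t ht ξ hξ
    have h1 := hK (ξ * t) (mul_pos hξ.1 ht.1)
    have h2 : ξ * t ≤ T := by nlinarith [hξ.1, hξ.2, ht.1, ht.2]
    have h3 : |ξ * t * f (ξ * t) ^ 2| ≤ T * K ^ 2 := by
      rw [abs_mul, abs_pow, abs_of_pos (mul_pos hξ.1 ht.1)]
      gcongr
    have h4 : |1 / Real.pi| = 1 / Real.pi := abs_of_pos (by positivity)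
    rw [abs_mul]
    calc _ ≤ 1 * |1 / Real.pi - ξ * t * f (ξ * t) ^ 2| := by gcongr; exact hw ξ hξ
      _ ≤ _ := by rw [one_mul]; exact (abs_sub _ _).trans (by rw [h4]; gcongr)
  have hmul : ∀ t > 0, ContinuousOn (fun ξ : ℝ => ξ * t) (Set.Ioo 0 1) ∧
      MapsTo (fun ξ : ℝ => ξ * t) (Set.Ioo 0 1) (Set.Ioi 0) := fun t ht =>
    ⟨by fun_prop, fun ξ hξ => mul_pos hξ.1 ht⟩
  have hP_int : ∀ (f : ℝ → ℝ) (K : ℝ), ContinuousOn f (Set.Ioi 0) → (∀ x > 0, |f x| ≤ K) →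
      IntegrableOn (fun ξ => (1 - ξ ^ 2) ^ a * (1 / Real.pi - ξ * T * f (ξ * T) ^ 2))
        (Set.Ioo 0 1) := by
    intro f K hf hK
    refine integrableOn_of_continuousOn_of_bound measurableSet_Ioo (by simp) ?_ _
      (hbound f K hK T ⟨hT, le_rfl⟩)
    exact hw_cont.continuousOn.mul (continuousOn_const.sub
      ((hmul T hT).1.mul ((hf.comp (hmul T hT).1 (hmul T hT).2).pow 2)))
  have huv_int : IntegrableOn (fun ξ => (1 - ξ ^ 2) ^ a * (u (ξ * T) * v (ξ * T)))
      (Set.Ioo 0 1) := by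
    refine integrableOn_of_continuousOn_of_bound measurableSet_Ioo (by simp) ?_ (1 * (M * N)) ?_
    · exact hw_cont.continuousOn.mul ((hu_cont.comp (hmul T hT).1 (hmul T hT).2).mul
        (hv_cont.comp (hmul T hT).1 (hmul T hT).2))
    · intro ξ hξ
      have h1 := hM _ (mul_pos hξ.1 hT)
      have h2 := hN _ (mul_pos hξ.1 hT)
      have h3 := hw ξ hξ
      have hM0 : 0 ≤ M := (abs_nonneg _).trans h1
      rw [abs_mul, abs_mul]
      gcongr
  have hprod_int : Integrable
      (Function.uncurry fun t ξ : ℝ =>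
        (1 - ξ ^ 2) ^ a * (1 / Real.pi - ξ * t * u (ξ * t) ^ 2))
      ((volume.restrict (Set.Ioc 0 T)).prod (volume.restrict (Set.Ioo 0 1))) := by
    rw [Measure.prod_restrict]
    refine integrableOn_of_continuousOn_of_bound (measurableSet_Ioc.prod measurableSet_Ioo)
      (by simp [Measure.prod_prod]) ?_ _ fun p hp => hbound u M hM p.1 hp.1 p.2 hp.2
    have hm : ContinuousOn (fun p : ℝ × ℝ => p.2 * p.1) (Set.Ioc 0 T ×ˢ Set.Ioo 0 1) := by
      fun_prop
    exact (hw_cont.comp continuous_snd).continuousOn.mul (continuousOn_const.sub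
      (hm.mul ((hu_cont.comp hm fun p hp => mul_pos hp.2.1 hp.1.1).pow 2)))
  have hinner : ∀ ξ ∈ Set.Ioo (0 : ℝ) 1,
      ∫ t in Set.Ioc 0 T, (1 - ξ ^ 2) ^ a * (1 / Real.pi - ξ * t * u (ξ * t) ^ 2) =
        T / 2 * ((1 - ξ ^ 2) ^ a * (1 / Real.pi - ξ * T * u (ξ * T) ^ 2) +
          (1 - ξ ^ 2) ^ a * (1 / Real.pi - ξ * T * v (ξ * T) ^ 2)) +
        ν * T * ((1 - ξ ^ 2) ^ a * (u (ξ * T) * v (ξ * T))) := by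
    intro ξ hξ
    have hξ0 := hξ.1
    have hi : IntegrableOn (fun t => ξ * t * u (ξ * t) ^ 2) (Set.Ioc 0 T) := by
      have hm : ContinuousOn (fun t : ℝ => ξ * t) (Set.Ioc 0 T) := by fun_prop
      refine integrableOn_of_continuousOn_of_bound measurableSet_Ioc (by simp)
        (hm.mul ((hu_cont.comp hm fun t ht => mul_pos hξ0 ht.1).pow 2)) (ξ * T * M ^ 2) ?_
      intro t ht
      have h1 := hM _ (mul_pos hξ0 ht.1)
      have h2 := ht.2
      rw [abs_mul, abs_pow, abs_of_pos (mul_pos hξ0 ht.1)]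
      gcongr
    rw [integral_const_mul, integral_sub (by simp) hi,
      integral_Ioc_comp_mul (g := fun s => s * u s ^ 2) hξ0 hT, hF _ (mul_pos hξ0 hT)]
    simp only [integral_const, measureReal_restrict_apply_univ, Real.volume_real_Ioc, smul_eq_mul,
      sub_zero, max_eq_left hT.le]
    field_simp
    ring
  have hchange : ∫ s in Set.Ioc 0 T, (1 - s ^ 2 / T ^ 2) ^ a * (u s * v s) =
      T * ∫ ξ in Set.Ioo 0 1, (1 - ξ ^ 2) ^ a * (u (ξ * T) * v (ξ * T)) := by
    have h := integral_Ioc_comp_mul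
      (g := fun s => (1 - s ^ 2 / T ^ 2) ^ a * (u s * v s)) hT one_pos
    rw [mul_one] at h
    rw [← integral_Ioc_eq_integral_Ioo, ← mul_inv_cancel_left₀ hT.ne' (∫ s in Set.Ioc 0 T, _), ← h]
    congr 2
    ext ξ
    rw [mul_comm T ξ, mul_pow, mul_div_cancel_right₀ _ (pow_ne_zero 2 hT.ne')]
  simp only [P, ← ha]
  rw [integral_integral_swap hprod_int, setIntegral_congr_fun measurableSet_Ioo hinner]
  refine (integral_add (((hP_int u M hu_cont hM).add (hP_int v N hv_cont hN)).const_mul _)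
    (huv_int.const_mul _)).trans ?_
  rw [integral_const_mul, integral_const_mul,
    integral_add' (hP_int u M hu_cont hM) (hP_int v N hv_cont hN), hchange]
  ring
end

section
/- Let d ≥ 1 be an integer and ν ≥ 0. Let u, v : (0,∞) → ℝ be continuous, bounded, satisfy the Bessel recurrence relations of order ν, and assume: (i) x²(u(x)² + v(x)²) → 0 and x u(x) v(x) → 0 as x → 0⁺; (ii) lim_{T→∞} ∫₀^T u(s) v(s) ds = 1/2; (iii) T (|P_u(T)| + |P_v(T)|) → 0 as T → ∞. Then lim_{T→∞} ∫₀^T P_u(t) dt = ν/2. -/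
open MeasureTheory Filter Set

/-- The weight `ξ ↦ (1 − ξ²)^{(d+1)/2}` in the definition of `P`. -/
noncomputable def sonineWeight (d : ℕ) (ξ : ℝ) : ℝ := (1 - ξ ^ 2) ^ (((d : ℝ) + 1) / 2)

/-- The derivative of `sonineWeight`. -/
noncomputable def sonineWeightDeriv (d : ℕ) (ξ : ℝ) : ℝ :=
  -(2 * ξ) * (((d : ℝ) + 1) / 2) * (1 - ξ ^ 2) ^ (((d : ℝ) + 1) / 2 - 1)

lemma continuous_sonineWeight (d : ℕ) : Continuous (sonineWeight d) :=
  (by fun_prop : Continuous fun ξ : ℝ => 1 - ξ ^ 2).rpow_const fun _ => Or.inr (by positivity)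

lemma abs_sonineWeight_le_one (d : ℕ) {ξ : ℝ} (hξ : ξ ∈ Ioo (0 : ℝ) 1) :
    |sonineWeight d ξ| ≤ 1 := by
  have h : 0 ≤ 1 - ξ ^ 2 := by nlinarith [hξ.1, hξ.2]
  rw [sonineWeight, abs_of_nonneg (Real.rpow_nonneg h _)]
  exact Real.rpow_le_one h (by nlinarith [hξ.1]) (by positivity)

lemma sonineWeight_zero (d : ℕ) : sonineWeight d 0 = 1 := by simp [sonineWeight]

lemma sonineWeight_one (d : ℕ) : sonineWeight d 1 = 0 := by
  rw [sonineWeight, one_pow, sub_self, Real.zero_rpow (by positivity)]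

lemma one_le_half_succ {d : ℕ} (hd : 1 ≤ d) : 1 ≤ ((d : ℝ) + 1) / 2 := by
  have : (1 : ℝ) ≤ d := by exact_mod_cast hd
  linarith

lemma hasDerivAt_sonineWeight {d : ℕ} (hd : 1 ≤ d) (ξ : ℝ) :
    HasDerivAt (sonineWeight d) (sonineWeightDeriv d ξ) ξ := by
  have h : HasDerivAt (fun ξ : ℝ => 1 - ξ ^ 2) (-(2 * ξ)) ξ := by
    simpa using (hasDerivAt_pow 2 ξ).const_sub 1
  exact h.rpow_const (Or.inr (one_le_half_succ hd))

lemma continuous_sonineWeightDeriv {d : ℕ} (hd : 1 ≤ d) : Continuous (sonineWeightDeriv d) := by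
  have h : Continuous fun ξ : ℝ => (1 - ξ ^ 2) ^ (((d : ℝ) + 1) / 2 - 1) :=
    (by fun_prop : Continuous fun ξ : ℝ => 1 - ξ ^ 2).rpow_const
      fun _ => Or.inr (by linarith [one_le_half_succ hd])
  unfold sonineWeightDeriv
  fun_prop

lemma P_eq_integral_sonineWeight (d : ℕ) (u : ℝ → ℝ) (t : ℝ) :
    P d u t = ∫ ξ in Ioo (0 : ℝ) 1,
      sonineWeight d ξ * (fun s => 1 / Real.pi - s * u s ^ 2) (ξ * t) := rfl

lemma intervalIntegrable_of_continuousOn_of_bounded {f : ℝ → ℝ} {C T : ℝ} (hT : 0 ≤ T)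
    (hf : ContinuousOn f (Ioi 0)) (hC : ∀ s ∈ Ioc 0 T, |f s| ≤ C) :
    IntervalIntegrable f volume 0 T := by
  rw [intervalIntegrable_iff_integrableOn_Ioc_of_le hT]
  exact IntegrableOn.of_bound (by simp)
    ((hf.mono Ioc_subset_Ioi_self).aestronglyMeasurable measurableSet_Ioc) C
    ((ae_restrict_iff' measurableSet_Ioc).2 (.of_forall hC))

lemma mul_mem_Ioc {ξ t T : ℝ} (hξ : ξ ∈ Ioo (0 : ℝ) 1) (ht : t ∈ Ioc 0 T) :
    ξ * t ∈ Ioc 0 T :=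
  ⟨mul_pos hξ.1 ht.1, by nlinarith [hξ.1, hξ.2, ht.1, ht.2]⟩

lemma abs_sonineWeight_mul_le {d : ℕ} {f : ℝ → ℝ} {C T ξ t : ℝ}
    (hC : ∀ s ∈ Ioc 0 T, |f s| ≤ C) (hξ : ξ ∈ Ioo (0 : ℝ) 1) (ht : t ∈ Ioc 0 T) :
    |sonineWeight d ξ * f (ξ * t)| ≤ C := by
  rw [abs_mul]
  have h1 := hC _ (mul_mem_Ioc hξ ht)
  nlinarith [abs_sonineWeight_le_one d hξ, abs_nonneg (f (ξ * t)), abs_nonneg (sonineWeight d ξ)]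

lemma integrableOn_sonineWeight_mul (d : ℕ) {f : ℝ → ℝ} {C T : ℝ} (hT : 0 < T)
    (hf : ContinuousOn f (Ioi 0)) (hC : ∀ s ∈ Ioc 0 T, |f s| ≤ C) :
    IntegrableOn (fun ξ => sonineWeight d ξ * f (ξ * T)) (Ioo 0 1) := by
  refine IntegrableOn.of_bound (by simp) ?_ C
    ((ae_restrict_iff' measurableSet_Ioo).2
      (.of_forall fun ξ hξ => abs_sonineWeight_mul_le hC hξ ⟨hT, le_rfl⟩))
  refine ContinuousOn.aestronglyMeasurable ?_ measurableSet_Ioo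
  exact (continuous_sonineWeight d).continuousOn.mul
    (hf.comp (by fun_prop) fun ξ hξ => mul_pos hξ.1 hT)

/-- Fubini for the dilations of a function against `sonineWeight`. -/
lemma integral_integral_sonineWeight_mul (d : ℕ) {f : ℝ → ℝ} {C T : ℝ} (hT : 0 < T)
    (hf : ContinuousOn f (Ioi 0)) (hC : ∀ s ∈ Ioc 0 T, |f s| ≤ C) :
    ∫ t in Ioc 0 T, ∫ ξ in Ioo (0 : ℝ) 1, sonineWeight d ξ * f (ξ * t) =
      ∫ ξ in Ioo (0 : ℝ) 1, sonineWeight d ξ * (ξ⁻¹ * ∫ s in (0)..(ξ * T), f s) := by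
  rw [integral_integral_swap]
  · refine setIntegral_congr_fun measurableSet_Ioo fun ξ hξ => ?_
    have h := intervalIntegral.integral_comp_mul_left (a := 0) (b := T) f hξ.1.ne'
    simp only [mul_zero, smul_eq_mul] at h
    simp only [integral_const_mul]
    rw [← intervalIntegral.integral_of_le hT.le, h]
  · rw [Measure.prod_restrict]
    have hms : MeasurableSet (Ioc (0 : ℝ) T ×ˢ Ioo (0 : ℝ) 1) :=
      measurableSet_Ioc.prod measurableSet_Ioo
    refine IntegrableOn.of_bound ?_ ?_ C
      ((ae_restrict_iff' hms).2 (.of_forall ?_))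
    · rw [Measure.prod_prod]
      simp
    · refine ContinuousOn.aestronglyMeasurable ?_ hms
      exact ((continuous_sonineWeight d).comp continuous_snd).continuousOn.mul
        (hf.comp (by fun_prop) fun p hp => mul_pos hp.2.1 hp.1.1)
    · rintro ⟨t, ξ⟩ ⟨ht, hξ⟩
      exact abs_sonineWeight_mul_le hC hξ ht

lemma hasDerivAt_integral_of_continuousOn_Ioi {q : ℝ → ℝ} {M x : ℝ}
    (hq : ContinuousOn q (Ioi 0)) (hM : ∀ s > 0, |q s| ≤ M) (hx : 0 < x) :
    HasDerivAt (fun x => ∫ s in (0)..x, q s) (q x) x :=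
  intervalIntegral.integral_hasDerivAt_right
    (intervalIntegrable_of_continuousOn_of_bounded hx.le hq fun s hs => hM s hs.1)
    (hq.stronglyMeasurableAtFilter isOpen_Ioi x hx) (hq.continuousAt (Ioi_mem_nhds hx))

lemma continuousOn_integral_of_continuousOn_Ioi {q : ℝ → ℝ} {M : ℝ}
    (hq : ContinuousOn q (Ioi 0)) (hM : ∀ s > 0, |q s| ≤ M) :
    ContinuousOn (fun x => ∫ s in (0)..x, q s) (Ici 0) := by
  intro x hx
  have h := intervalIntegral.continuousOn_primitive_interval (μ := volume) (f := q)
    (a := 0) (b := x + 1) (by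
      rw [uIcc_of_le (by linarith [mem_Ici.1 hx]), integrableOn_Icc_iff_integrableOn_Ioc]
      exact (intervalIntegrable_of_continuousOn_of_bounded (by linarith [mem_Ici.1 hx]) hq
        fun s hs => hM s hs.1).1)
  rw [uIcc_of_le (by linarith [mem_Ici.1 hx])] at h
  refine (h x ⟨hx, by linarith⟩).mono_of_mem_nhdsWithin ?_
  rw [← Ici_inter_Iic]
  exact inter_mem_nhdsWithin _ (Iic_mem_nhds (by linarith))

/-- Abel summation: averaging the dilations of an improperly integrable function against
`sonineWeight` recovers its improper integral, by integration by parts. -/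
lemma tendsto_integral_sonineWeight_mul {d : ℕ} (hd : 1 ≤ d) {q : ℝ → ℝ} {M L : ℝ}
    (hq : ContinuousOn q (Ioi 0)) (hM : ∀ s > 0, |q s| ≤ M)
    (hL : Tendsto (fun T => ∫ s in (0)..T, q s) atTop (nhds L)) :
    Tendsto (fun T => T * ∫ ξ in Ioo (0 : ℝ) 1, sonineWeight d ξ * q (ξ * T))
      atTop (nhds L) := by
  set G : ℝ → ℝ := fun x => ∫ s in (0)..x, q s with hG
  have hGc : ContinuousOn G (Ici 0) := continuousOn_integral_of_continuousOn_Ioi hq hM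
  obtain ⟨B, hB⟩ : ∃ B, ∀ x ≥ 0, |G x| ≤ B := by
    obtain ⟨N, hN⟩ := eventually_atTop.1 (hL.abs.eventually_le_const (lt_add_one |L|))
    obtain ⟨B, hB⟩ := (isCompact_Icc (a := (0 : ℝ)) (b := N)).exists_bound_of_continuousOn
      (hGc.mono Icc_subset_Ici_self)
    refine ⟨max B (|L| + 1), fun x hx => ?_⟩
    rcases le_total x N with h | h
    · exact (hB x ⟨hx, h⟩).trans (le_max_left _ _)
    · exact (hN x h).trans (le_max_right _ _)
  have hGdil : ∀ T > 0, ContinuousOn (fun ξ => G (ξ * T)) (Icc 0 1) := fun T hT =>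
    hGc.comp (by fun_prop) fun ξ hξ => mul_nonneg hξ.1 hT.le
  have hw' := continuous_sonineWeightDeriv hd
  have parts : ∀ T > 0, T * ∫ ξ in Ioo (0 : ℝ) 1, sonineWeight d ξ * q (ξ * T) =
      -∫ ξ in (0)..1, sonineWeightDeriv d ξ * G (ξ * T) := by
    intro T hT
    have hint1 : IntervalIntegrable (fun ξ => sonineWeightDeriv d ξ * G (ξ * T)) volume 0 1 := by
      refine ContinuousOn.intervalIntegrable ?_
      rw [uIcc_of_le zero_le_one]
      exact hw'.continuousOn.mul (hGdil T hT)
    have hint2 : IntervalIntegrable (fun ξ => T * (sonineWeight d ξ * q (ξ * T))) volume 0 1 := by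
      rw [intervalIntegrable_iff_integrableOn_Ioo_of_le zero_le_one]
      exact (integrableOn_sonineWeight_mul d hT hq fun s hs => hM s hs.1).const_mul T
    have h := intervalIntegral.integral_eq_sub_of_hasDerivAt_of_le zero_le_one
      (f := fun ξ => sonineWeight d ξ * G (ξ * T))
      ((continuous_sonineWeight d).continuousOn.mul (hGdil T hT))
      (fun ξ hξ => ?_) (hint1.add hint2)
    · rw [intervalIntegral.integral_add hint1 hint2, intervalIntegral.integral_const_mul,
        intervalIntegral.integral_of_le zero_le_one (f := fun ξ => sonineWeight d ξ * _),
        integral_Ioc_eq_integral_Ioo] at h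
      simp only [sonineWeight_one, zero_mul, hG, intervalIntegral.integral_same, mul_zero,
        sub_zero] at h
      linarith
    · have hq' := hasDerivAt_integral_of_continuousOn_Ioi hq hM (mul_pos hξ.1 hT)
      have h1 : HasDerivAt (fun ξ => G (ξ * T)) (q (ξ * T) * T) ξ :=
        HasDerivAt.comp (h₂ := G) ξ hq' (hasDerivAt_mul_const T)
      exact ((hasDerivAt_sonineWeight hd ξ).mul h1).congr_deriv (by ring)
  have hlim : Tendsto (fun T => ∫ ξ in (0)..1, sonineWeightDeriv d ξ * G (ξ * T)) atTop
      (nhds (∫ ξ in (0)..1, sonineWeightDeriv d ξ * L)) := by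
    refine intervalIntegral.tendsto_integral_filter_of_dominated_convergence
      (fun ξ => |sonineWeightDeriv d ξ| * B) ?_ ?_ ?_ ?_
    · filter_upwards [eventually_gt_atTop 0] with T hT
      rw [uIoc_of_le zero_le_one]
      exact ((hw'.continuousOn.mul (hGdil T hT)).mono Ioc_subset_Icc_self).aestronglyMeasurable
        measurableSet_Ioc
    · filter_upwards [eventually_gt_atTop 0] with T hT
      refine .of_forall fun ξ hξ => ?_
      rw [uIoc_of_le zero_le_one] at hξ
      rw [Real.norm_eq_abs, abs_mul]
      exact mul_le_mul_of_nonneg_left (hB _ (mul_nonneg hξ.1.le hT.le)) (abs_nonneg _)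
    · exact (hw'.abs.mul continuous_const).intervalIntegrable _ _
    · refine .of_forall fun ξ hξ => ?_
      rw [uIoc_of_le zero_le_one] at hξ
      exact (hL.comp (tendsto_id.const_mul_atTop hξ.1)).const_mul _
  have htotal : ∫ ξ in (0)..1, sonineWeightDeriv d ξ = -1 := by
    rw [intervalIntegral.integral_eq_sub_of_hasDerivAt
      (fun ξ _ => hasDerivAt_sonineWeight hd ξ) (hw'.intervalIntegrable _ _),
      sonineWeight_zero, sonineWeight_one, zero_sub]
  rw [intervalIntegral.integral_mul_const, htotal] at hlim
  refine (by simpa using hlim.neg : Tendsto _ atTop (nhds L)).congr' ?_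
  filter_upwards [eventually_gt_atTop 0] with T hT using (parts T hT).symm

/-- The Lommel-type primitive of `s u(s)²` given by the Bessel recurrence relations. -/
lemma integral_mul_sq_of_bessel_recurrence {ν : ℝ} {u v : ℝ → ℝ} {M x : ℝ} (hx : 0 < x)
    (hu_cont : ContinuousOn u (Ioi 0)) (hM : ∀ s > 0, |u s| ≤ M)
    (hu : ∀ x > (0 : ℝ), HasDerivAt u (ν / x * u x - v x) x)
    (hv : ∀ x > (0 : ℝ), HasDerivAt v (u x - (ν + 1) / x * v x) x)
    (hlim1 : Tendsto (fun x => x ^ 2 * ((u x) ^ 2 + (v x) ^ 2)) (nhdsWithin 0 (Ioi 0)) (nhds 0))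
    (hlim2 : Tendsto (fun x => x * u x * v x) (nhdsWithin 0 (Ioi 0)) (nhds 0)) :
    IntervalIntegrable (fun s => s * u s ^ 2) volume 0 x ∧
    ∫ s in (0)..x, s * u s ^ 2 = x ^ 2 * (u x ^ 2 + v x ^ 2) / 2 - ν * (x * u x * v x) := by
  have hint : IntervalIntegrable (fun s => s * u s ^ 2) volume 0 x := by
    refine intervalIntegrable_of_continuousOn_of_bounded (C := x * M ^ 2) hx.le (by fun_prop)
      fun s hs => ?_
    rw [abs_mul, abs_of_pos hs.1, abs_pow]
    have := hM s hs.1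
    have := hs.2
    gcongr
  refine ⟨hint, ?_⟩
  have hderiv : ∀ y > 0, HasDerivAt
      (fun x => x ^ 2 * (u x ^ 2 + v x ^ 2) / 2 - ν * (x * u x * v x)) (y * u y ^ 2) y := by
    intro y hy
    have h1 := (((hasDerivAt_pow 2 y).mul (((hu y hy).pow 2).add ((hv y hy).pow 2))).div_const 2).sub
      ((((hasDerivAt_id y).mul (hu y hy)).mul (hv y hy)).const_mul ν)
    refine h1.congr_deriv ?_
    have : y ≠ 0 := hy.ne'
    simp only [Pi.mul_apply, Pi.add_apply, Pi.pow_apply, id]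
    field_simp
    push_cast
    ring
  have h := intervalIntegral.integral_eq_sub_of_hasDerivAt_of_tendsto hx
    (fun y hy => hderiv y hy.1) hint
    (by simpa using (hlim1.div_const 2).sub (hlim2.const_mul ν))
    ((hderiv x hx).continuousAt.tendsto.mono_left nhdsWithin_le_nhds)
  rw [h, sub_zero]

/-- The integral of `P d u` over `(0, T]`, in terms of values at `T`. -/
lemma integral_P_eq (d : ℕ) {ν : ℝ} {u v : ℝ → ℝ} {M N T : ℝ} (hT : 0 < T)
    (hu_cont : ContinuousOn u (Ioi 0)) (hv_cont : ContinuousOn v (Ioi 0))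
    (hM : ∀ x > (0 : ℝ), |u x| ≤ M) (hN : ∀ x > (0 : ℝ), |v x| ≤ N)
    (hu : ∀ x > (0 : ℝ), HasDerivAt u (ν / x * u x - v x) x)
    (hv : ∀ x > (0 : ℝ), HasDerivAt v (u x - (ν + 1) / x * v x) x)
    (hlim1 : Tendsto (fun x => x ^ 2 * ((u x) ^ 2 + (v x) ^ 2)) (nhdsWithin 0 (Ioi 0)) (nhds 0))
    (hlim2 : Tendsto (fun x => x * u x * v x) (nhdsWithin 0 (Ioi 0)) (nhds 0)) :
    ∫ t in Ioc (0 : ℝ) T, P d u t = T / 2 * (P d u T + P d v T) +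
      ν * (T * ∫ ξ in Ioo (0 : ℝ) 1, sonineWeight d ξ * (fun s => u s * v s) (ξ * T)) := by
  have bound : ∀ {f : ℝ → ℝ} {K : ℝ}, (∀ x > (0 : ℝ), |f x| ≤ K) → ∀ s ∈ Ioc 0 T,
      |1 / Real.pi - s * f s ^ 2| ≤ 1 / Real.pi + T * K ^ 2 := by
    intro f K hK s hs
    refine (abs_sub _ _).trans ?_
    rw [abs_of_nonneg (by positivity), abs_mul, abs_of_pos hs.1, abs_pow]
    have := hK s hs.1
    have := hs.2
    gcongr
  have hφu : ContinuousOn (fun s => 1 / Real.pi - s * u s ^ 2) (Ioi 0) := by fun_prop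
  have hφv : ContinuousOn (fun s => 1 / Real.pi - s * v s ^ 2) (Ioi 0) := by fun_prop
  have iu := integrableOn_sonineWeight_mul d hT hφu (bound hM)
  have iv := integrableOn_sonineWeight_mul d hT hφv (bound hN)
  have iq := integrableOn_sonineWeight_mul d hT (f := fun s => u s * v s) (hu_cont.mul hv_cont)
    (C := M * N) fun s hs => by
      rw [abs_mul]
      exact mul_le_mul (hM s hs.1) (hN s hs.1) (abs_nonneg _) ((abs_nonneg _).trans (hM s hs.1))
  simp only [P_eq_integral_sonineWeight]
  rw [integral_integral_sonineWeight_mul d hT hφu (bound hM), ← integral_add iu iv,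
    ← integral_const_mul, ← integral_const_mul, ← integral_const_mul]
  refine Eq.trans ?_ (integral_add ((iu.add iv).const_mul (T / 2)) ((iq.const_mul T).const_mul ν))
  refine setIntegral_congr_fun measurableSet_Ioo fun ξ hξ => ?_
  obtain ⟨hint, hval⟩ := integral_mul_sq_of_bessel_recurrence (mul_pos hξ.1 hT) hu_cont hM hu hv
    hlim1 hlim2
  have : ξ ≠ 0 := hξ.1.ne'
  rw [intervalIntegral.integral_sub intervalIntegrable_const hint, hval,
    intervalIntegral.integral_const]
  simp only [smul_eq_mul, sub_zero]
  field_simp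
  ring

/-- Lemma A.2 of the paper: if `u, v` are continuous, bounded, satisfy the Bessel
recurrence relations of order `ν ≥ 0`, the boundary limits (i) hold,
`∫₀^∞ u v = 1/2`, and `T(|P_u(T)| + |P_v(T)|) → 0`, then
`∫₀^∞ P_u(t) dt = ν/2`. -/
theorem P_total_integral (d : ℕ) (hd : 1 ≤ d) (ν : ℝ) (hν : 0 ≤ ν) (u v : ℝ → ℝ)
    (hu_cont : ContinuousOn u (Set.Ioi 0)) (hv_cont : ContinuousOn v (Set.Ioi 0))
    (hu_bdd : ∃ M : ℝ, ∀ x > (0 : ℝ), |u x| ≤ M)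
    (hv_bdd : ∃ M : ℝ, ∀ x > (0 : ℝ), |v x| ≤ M)
    (hu : ∀ x > (0 : ℝ), HasDerivAt u (ν / x * u x - v x) x)
    (hv : ∀ x > (0 : ℝ), HasDerivAt v (u x - (ν + 1) / x * v x) x)
    (hlim1 : Tendsto (fun x => x ^ 2 * ((u x) ^ 2 + (v x) ^ 2))
      (nhdsWithin 0 (Set.Ioi 0)) (nhds 0))
    (hlim2 : Tendsto (fun x => x * u x * v x) (nhdsWithin 0 (Set.Ioi 0)) (nhds 0))
    (hint : Tendsto (fun T : ℝ => ∫ s in Set.Ioc (0 : ℝ) T, u s * v s)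
      atTop (nhds (1 / 2)))
    (hdecay : Tendsto (fun T : ℝ => T * (|P d u T| + |P d v T|)) atTop (nhds 0)) :
    Tendsto (fun T : ℝ => ∫ t in Set.Ioc (0 : ℝ) T, P d u t)
      atTop (nhds (ν / 2)) := by
  obtain ⟨M, hM⟩ := hu_bdd
  obtain ⟨N, hN⟩ := hv_bdd
  have hboundary : Tendsto (fun T => T / 2 * (P d u T + P d v T)) atTop (nhds 0) := by
    refine squeeze_zero_norm' ?_ hdecay
    filter_upwards [eventually_gt_atTop 0] with T hT
    rw [Real.norm_eq_abs, abs_mul, abs_of_pos (half_pos hT)]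
    exact mul_le_mul (half_le_self hT.le) (abs_add_le _ _) (abs_nonneg _) hT.le
  have hbulk := tendsto_integral_sonineWeight_mul hd (q := fun s => u s * v s) (M := M * N)
    (hu_cont.mul hv_cont)
    (fun s hs => by
      rw [abs_mul]
      exact mul_le_mul (hM s hs) (hN s hs) (abs_nonneg _) ((abs_nonneg _).trans (hM s hs)))
    (hint.congr' (by
      filter_upwards [eventually_ge_atTop 0] with T hT
        using (intervalIntegral.integral_of_le hT).symm))
  have hsum := hboundary.add (hbulk.const_mul ν)
  rw [zero_add, mul_one_div] at hsum
  refine hsum.congr' ?_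
  filter_upwards [eventually_gt_atTop 0] with T hT
    using (integral_P_eq d hT hu_cont hv_cont hM hN hu hv hlim1 hlim2).symm
end
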